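/- arXiv:0909.3141 — 6 statements merged into one kernel-verified Lean document; each statement's English description precedes it below -/
import Mathlib

section
/- Let μ ∈ {1, −1}, T > 0. Let f ∈ C^∞(ℝ×[0,T] → ℂ) satisfy: for every n ∈ ℕ there is C > 0 with |∂_x^n f(x,t)| ≤ C⟨x⟩^(−n) for all x ∈ ℝ and t ∈ [0,T]. Let g ∈ S^(−∞)(ℝ×[0,T] → ℂ). If u, v ∈ S^(−∞)(ℝ×[0,T] → ℂ) both satisfy i∂_t w + ∂_x² w + μ(w²·conj(w) + w²·conj(f) + f²·conj(w) + 2·w·f·conj(w) + 2·w·f·conj(f)) + g = 0 on ℝ×[0,T] and u(x,0) = v(x,0) for all x ∈ ℝ, then u(x,t) = v(x,t) for all (x,t) ∈ ℝ×[0,T]. -/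
noncomputable section

/-- The Japanese bracket `⟨x⟩ = √(x² + 1)`. -/
def jb (x : ℝ) : ℝ := Real.sqrt (x ^ 2 + 1)

/-- Mixed partial derivative `∂_t^i ∂_x^j u (x, t)`. -/
def pd (u : ℝ → ℝ → ℂ) (i j : ℕ) (x t : ℝ) : ℂ :=
  iteratedDeriv i (fun s => iteratedDeriv j (fun y => u y s) x) t

/-- Joint smoothness (`C^∞`) of a function of two real variables. -/
def Smooth2 (u : ℝ → ℝ → ℂ) : Prop := ∀ n : ℕ, ContDiff ℝ n (Function.uncurry u)

/-- Membership in `S^{-∞}(ℝ × [0,T] → ℂ)`. -/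
def SMinusInfOn (u : ℝ → ℝ → ℂ) (T : ℝ) : Prop :=
  Smooth2 u ∧ ∀ N i j : ℕ, ∃ C > (0 : ℝ), ∀ x : ℝ, ∀ t ∈ Set.Icc (0 : ℝ) T,
    ‖pd u i j x t‖ ≤ C * jb x ^ (-(N : ℝ))

/-- The generalized NLS equation for `w` on `ℝ × [0,T]` with background `f` and source `g`. -/
def GNLSEq (μ : ℝ) (f g w : ℝ → ℝ → ℂ) (T : ℝ) : Prop :=
  ∀ x : ℝ, ∀ t ∈ Set.Icc (0 : ℝ) T,
    Complex.I * pd w 1 0 x t + pd w 0 2 x t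
      + (μ : ℂ) * ((w x t) ^ 2 * (starRingEnd ℂ) (w x t)
          + (w x t) ^ 2 * (starRingEnd ℂ) (f x t)
          + (f x t) ^ 2 * (starRingEnd ℂ) (w x t)
          + 2 * w x t * f x t * (starRingEnd ℂ) (w x t)
          + 2 * w x t * f x t * (starRingEnd ℂ) (f x t))
      + g x t = 0

open MeasureTheory Set in
/-- Uniqueness for `w_t = i (w_xx + h)` with `‖h‖ ≤ K ‖w‖` and zero initial data, by the `L²` energy
estimate. -/
theorem eq_zero_of_schrodinger_energy {w wx wxx h : ℝ → ℝ → ℂ} {T C K : ℝ}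
    (hwx : ∀ x, ∀ t ∈ Icc 0 T, HasDerivAt (fun y => w y t) (wx x t) x)
    (hwxx : ∀ x, ∀ t ∈ Icc 0 T, HasDerivAt (fun y => wx y t) (wxx x t) x)
    (hwt : ∀ x, ∀ t ∈ Icc 0 T,
      HasDerivAt (fun s => w x s) (Complex.I * (wxx x t + h x t)) t)
    (hcxx : ∀ t ∈ Icc 0 T, Continuous fun x => wxx x t)
    (hch : ∀ t ∈ Icc 0 T, Continuous fun x => h x t)
    (hh : ∀ x, ∀ t ∈ Icc 0 T, ‖h x t‖ ≤ K * ‖w x t‖) (hK : 0 ≤ K) (hC : 0 ≤ C)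
    (bw : ∀ x, ∀ t ∈ Icc 0 T, ‖w x t‖ ≤ C * (1 + x ^ 2)⁻¹)
    (bwx : ∀ x, ∀ t ∈ Icc 0 T, ‖wx x t‖ ≤ C)
    (bwxx : ∀ x, ∀ t ∈ Icc 0 T, ‖wxx x t‖ ≤ C)
    (h0 : ∀ x, w x 0 = 0) :
    ∀ x, ∀ t ∈ Icc 0 T, w x t = 0 := by
  have cw : ∀ t ∈ Icc 0 T, Continuous fun x => w x t := fun t ht =>
    continuous_iff_continuousAt.2 fun x => (hwx x t ht).continuousAt
  have cwx : ∀ t ∈ Icc 0 T, Continuous fun x => wx x t := fun t ht =>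
    continuous_iff_continuousAt.2 fun x => (hwxx x t ht).continuousAt
  have decay_le : ∀ x : ℝ, (1 + x ^ 2)⁻¹ ≤ 1 := fun x =>
    inv_le_one_of_one_le₀ (by nlinarith [sq_nonneg x])
  have bw' : ∀ x, ∀ t ∈ Icc 0 T, ‖w x t‖ ≤ C := fun x t ht =>
    (bw x t ht).trans (mul_le_of_le_one_right hC (decay_le x))
  have integrable_decay : ∀ c : ℝ, Integrable fun x : ℝ => c * (1 + x ^ 2)⁻¹ := fun c =>
    integrable_inv_one_add_sq.const_mul c
  set q : ℝ → ℝ → ℝ := fun t x => Complex.normSq (w x t) with hq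
  set G : ℝ → ℝ → ℝ := fun t x =>
    2 * ((starRingEnd ℂ) (w x t) * (Complex.I * (wxx x t + h x t))).re with hG
  have dq : ∀ x, ∀ t ∈ Icc 0 T, HasDerivAt (fun s => q s x) (G t x) t := by
    intro x t ht
    have hre := Complex.reCLM.hasFDerivAt.comp_hasDerivAt t (hwt x t ht)
    have him := Complex.imCLM.hasFDerivAt.comp_hasDerivAt t (hwt x t ht)
    refine ((hre.mul hre).add (him.mul him)).congr_deriv ?_
    simp [hG]
    ring
  have cq : ∀ t ∈ Icc 0 T, Continuous (q t) := fun t ht =>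
    Complex.continuous_normSq.comp (cw t ht)
  have bq : ∀ x, ∀ t ∈ Icc 0 T, ‖q t x‖ ≤ C * C * (1 + x ^ 2)⁻¹ := by
    intro x t ht
    have : ‖q t x‖ = ‖w x t‖ * ‖w x t‖ := by
      rw [Real.norm_of_nonneg (Complex.normSq_nonneg _), Complex.normSq_eq_norm_sq, sq]
    rw [this, mul_assoc]
    exact mul_le_mul (bw' x t ht) (bw x t ht) (norm_nonneg _) hC
  have iq : ∀ t ∈ Icc 0 T, Integrable (q t) := fun t ht =>
    (integrable_decay _).mono' (cq t ht).aestronglyMeasurable (ae_of_all _ fun x => bq x t ht)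
  have cG : ∀ t ∈ Icc 0 T, Continuous (G t) := fun t ht =>
    continuous_const.mul (Complex.continuous_re.comp
      ((Complex.continuous_conj.comp (cw t ht)).mul
        (continuous_const.mul ((hcxx t ht).add (hch t ht)))))
  have bG : ∀ x, ∀ t ∈ Icc 0 T, ‖G t x‖ ≤ 2 * C * (C + K * C) * (1 + x ^ 2)⁻¹ := by
    intro x t ht
    have h1 : ‖wxx x t + h x t‖ ≤ C + K * C := (norm_add_le _ _).trans
      (add_le_add (bwxx x t ht) ((hh x t ht).trans
        (mul_le_mul_of_nonneg_left (bw' x t ht) hK)))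
    calc ‖G t x‖ ≤ 2 * (‖w x t‖ * ‖wxx x t + h x t‖) := by
          simp only [hG, norm_mul, Real.norm_ofNat]
          gcongr
          refine (Complex.abs_re_le_norm _).trans ?_
          simp
      _ ≤ 2 * ((C * (1 + x ^ 2)⁻¹) * (C + K * C)) := by
          have := mul_le_mul (bw x t ht) h1 (norm_nonneg _) (by positivity)
          linarith
      _ = _ := by ring
  have flux : ∀ t ∈ Icc 0 T,
      Integrable (fun x => ((starRingEnd ℂ) (w x t) * (Complex.I * wxx x t)).re) ∧
      ∫ x, ((starRingEnd ℂ) (w x t) * (Complex.I * wxx x t)).re = 0 := by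
    intro t ht
    have bound : ∀ (z : ℝ → ℂ), Continuous z → (∀ x, ‖z x‖ ≤ C) →
        Integrable (fun x => ((starRingEnd ℂ) (w x t) * (Complex.I * z x)).re) := by
      intro z hz hzC
      refine (integrable_decay (C * C)).mono' (Complex.continuous_re.comp
        ((Complex.continuous_conj.comp (cw t ht)).mul
          (continuous_const.mul hz))).aestronglyMeasurable (ae_of_all _ fun x => ?_)
      refine (Complex.abs_re_le_norm _).trans ?_
      have := mul_le_mul (bw x t ht) (hzC x) (norm_nonneg _) (by positivity)
      simp only [norm_mul, RCLike.norm_conj, Complex.norm_I, one_mul]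
      linarith
    have i2 := bound (fun x => wxx x t) (hcxx t ht) fun x => bwxx x t ht
    refine ⟨i2, integral_eq_zero_of_hasDerivAt_of_integrable
      (f := fun x => ((starRingEnd ℂ) (w x t) * (Complex.I * wx x t)).re) (fun x => ?_) i2
      (bound (fun x => wx x t) (cwx t ht) fun x => bwx x t ht)⟩
    have hconj := Complex.conjCLE.toContinuousLinearMap.hasFDerivAt.comp_hasDerivAt x (hwx x t ht)
    have := Complex.reCLM.hasFDerivAt.comp_hasDerivAt x
      (hconj.mul ((hwxx x t ht).const_mul Complex.I))
    refine this.congr_deriv ?_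
    simp
    ring
  have intG : ∀ t ∈ Icc 0 T, ∫ x, G t x ≤ 2 * K * ∫ x, q t x := by
    intro t ht
    obtain ⟨i2, e2⟩ := flux t ht
    have e : ∫ x, (G t x - 2 * ((starRingEnd ℂ) (w x t) * (Complex.I * wxx x t)).re)
        = ∫ x, G t x := by
      rw [integral_sub ((integrable_decay _).mono' (cG t ht).aestronglyMeasurable
        (ae_of_all _ fun x => bG x t ht)) (i2.const_mul 2),
        integral_const_mul 2 fun x => ((starRingEnd ℂ) (w x t) * (Complex.I * wxx x t)).re, e2]
      simp
    rw [← e, ← integral_const_mul]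
    refine integral_mono (((integrable_decay _).mono' (cG t ht).aestronglyMeasurable
        (ae_of_all _ fun x => bG x t ht)).sub (i2.const_mul 2)) ((iq t ht).const_mul _)
        fun x => ?_
    have e3 : G t x - 2 * ((starRingEnd ℂ) (w x t) * (Complex.I * wxx x t)).re
        = 2 * ((starRingEnd ℂ) (w x t) * (Complex.I * h x t)).re := by
      simp only [hG, mul_add, Complex.add_re]
      ring
    have h4 : ((starRingEnd ℂ) (w x t) * (Complex.I * h x t)).re ≤ ‖w x t‖ * ‖h x t‖ := by
      refine (Complex.re_le_norm _).trans ?_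
      simp
    have h5 := mul_le_mul_of_nonneg_left (hh x t ht) (norm_nonneg (w x t))
    simp only [e3, hq, Complex.normSq_eq_norm_sq]
    nlinarith
  set E : ℝ → ℝ := fun t => ∫ x, q t x with hE
  have cE : ContinuousOn E (Icc 0 T) :=
    continuousOn_of_dominated (fun t ht => (cq t ht).aestronglyMeasurable)
      (fun t ht => ae_of_all _ fun x => bq x t ht) (integrable_decay _)
      (ae_of_all _ fun x t ht => (dq x t ht).continuousAt.continuousWithinAt)
  have dE : ∀ t ∈ Ioo 0 T, HasDerivAt E (∫ x, G t x) t := by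
    intro t ht
    have ht' := Ioo_subset_Icc_self ht
    have hs : Icc 0 T ∈ nhds t := Icc_mem_nhds ht.1 ht.2
    exact (hasDerivAt_integral_of_dominated_loc_of_deriv_le (F := q) (F' := G) hs
      (Filter.eventually_of_mem hs fun s hs => (cq s hs).aestronglyMeasurable) (iq t ht')
      (cG t ht').aestronglyMeasurable (ae_of_all _ fun x s hs => bG x s hs) (integrable_decay _)
      (ae_of_all _ fun x s hs => dq x s hs)).2
  have dexp : ∀ t ∈ Ioo 0 T, HasDerivAt (fun t => Real.exp (-(2 * K) * t) * E t)
      (Real.exp (-(2 * K) * t) * (∫ x, G t x) - 2 * K * (Real.exp (-(2 * K) * t) * E t)) t := by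
    intro t ht
    refine ((((hasDerivAt_id t).const_mul (-(2 * K))).exp).mul (dE t ht)).congr_deriv ?_
    simp
    ring
  have anti : AntitoneOn (fun t => Real.exp (-(2 * K) * t) * E t) (Icc 0 T) := by
    refine antitoneOn_of_deriv_nonpos (convex_Icc 0 T)
      ((by fun_prop : Continuous fun t : ℝ => Real.exp (-(2 * K) * t)).continuousOn.mul cE) ?_ ?_
    · rw [interior_Icc]
      exact fun t ht => (dexp t ht).differentiableAt.differentiableWithinAt
    · rw [interior_Icc]
      intro t ht
      rw [(dexp t ht).deriv]
      have := mul_le_mul_of_nonneg_left (intG t (Ioo_subset_Icc_self ht))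
        (Real.exp_pos (-(2 * K) * t)).le
      simp only [hE]
      linarith
  intro x t ht
  have E0 : E 0 = 0 := by simp [hE, hq, h0]
  have hEt : Real.exp (-(2 * K) * t) * E t ≤ 0 := by
    have := anti (left_mem_Icc.2 (ht.1.trans ht.2)) ht ht.1
    simpa [E0] using this
  have hEt0 : E t = 0 := le_antisymm (nonpos_of_mul_nonpos_right hEt (Real.exp_pos _))
    (integral_nonneg fun x => Complex.normSq_nonneg _)
  have hae := (integral_eq_zero_iff_of_nonneg (fun x => Complex.normSq_nonneg _) (iq t ht)).1 hEt0
  have hfun := (Continuous.ae_eq_iff_eq volume (cq t ht) continuous_const).1 hae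
  exact Complex.normSq_eq_zero.1 (congrFun hfun x)

theorem jb_rpow_neg_two (x : ℝ) : jb x ^ (-((2 : ℕ) : ℝ)) = (1 + x ^ 2)⁻¹ := by
  have h : 0 ≤ x ^ 2 + 1 := by positivity
  rw [jb, Real.rpow_neg (Real.sqrt_nonneg _), Real.rpow_natCast, Real.sq_sqrt h, add_comm]

theorem jb_rpow_neg_zero (x : ℝ) : jb x ^ (-((0 : ℕ) : ℝ)) = 1 := by
  simp

theorem Smooth2.slice_left {u : ℝ → ℝ → ℂ} (hu : Smooth2 u) (n : ℕ) (t : ℝ) :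
    ContDiff ℝ n fun x => u x t :=
  (hu n).comp (contDiff_id.prodMk contDiff_const)

theorem Smooth2.slice_right {u : ℝ → ℝ → ℂ} (hu : Smooth2 u) (n : ℕ) (x : ℝ) :
    ContDiff ℝ n fun t => u x t :=
  (hu n).comp (contDiff_const.prodMk contDiff_id)

theorem Smooth2.hasDerivAt_pd {u : ℝ → ℝ → ℂ} (hu : Smooth2 u) (j : ℕ) (x t : ℝ) :
    HasDerivAt (fun y => pd u 0 j y t) (pd u 0 (j + 1) x t) x := by
  simp only [pd, iteratedDeriv_zero, iteratedDeriv_succ]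
  exact ((hu.slice_left (j + 1) t).differentiable_iteratedDeriv j
    (by exact_mod_cast Nat.lt_succ_self j) x).hasDerivAt

theorem Smooth2.hasDerivAt_time {u : ℝ → ℝ → ℂ} (hu : Smooth2 u) (x t : ℝ) :
    HasDerivAt (fun s => u x s) (pd u 1 0 x t) t := by
  simp only [pd, iteratedDeriv_zero, iteratedDeriv_one]
  exact ((hu.slice_right 1 x).differentiable (by simp) t).hasDerivAt

/-- Local Lipschitz bound for the nonlinearity of the generalized NLS equation. -/
theorem norm_nonlinearity_sub_le {a b c : ℂ} {M : ℝ}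
    (ha : ‖a‖ ≤ M) (hb : ‖b‖ ≤ M) (hc : ‖c‖ ≤ M) :
    ‖(a ^ 2 * (starRingEnd ℂ) a + a ^ 2 * (starRingEnd ℂ) c + c ^ 2 * (starRingEnd ℂ) a
        + 2 * a * c * (starRingEnd ℂ) a + 2 * a * c * (starRingEnd ℂ) c)
      - (b ^ 2 * (starRingEnd ℂ) b + b ^ 2 * (starRingEnd ℂ) c + c ^ 2 * (starRingEnd ℂ) b
        + 2 * b * c * (starRingEnd ℂ) b + 2 * b * c * (starRingEnd ℂ) c)‖
      ≤ 12 * M ^ 2 * ‖a - b‖ := by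
  have hM : 0 ≤ M := (norm_nonneg a).trans ha
  have h1 : ‖(a + b) * (starRingEnd ℂ) (a + c) + 2 * c * (starRingEnd ℂ) (a + c)‖
      ≤ 8 * M ^ 2 := by
    rw [← add_mul, norm_mul, RCLike.norm_conj]
    have e1 : ‖a + b + 2 * c‖ ≤ 4 * M := by
      refine (norm_add₃_le).trans ?_
      rw [norm_mul, Complex.norm_ofNat]
      linarith
    have e2 : ‖a + c‖ ≤ 2 * M := (norm_add_le _ _).trans (by linarith)
    have := mul_le_mul e1 e2 (norm_nonneg _) (by positivity)
    linarith
  have h2 : ‖(b + c) ^ 2‖ ≤ 4 * M ^ 2 := by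
    rw [norm_pow]
    have e2 : ‖b + c‖ ≤ 2 * M := (norm_add_le _ _).trans (by linarith)
    have := pow_le_pow_left₀ (norm_nonneg _) e2 2
    linarith
  calc _ = ‖((a + b) * (starRingEnd ℂ) (a + c) + 2 * c * (starRingEnd ℂ) (a + c)) * (a - b)
        + (b + c) ^ 2 * (starRingEnd ℂ) (a - b)‖ := by
        congr 1
        simp only [map_add, map_sub]
        ring
    _ ≤ 8 * M ^ 2 * ‖a - b‖ + 4 * M ^ 2 * ‖a - b‖ := by
        refine (norm_add_le _ _).trans ?_
        rw [norm_mul, norm_mul _ ((starRingEnd ℂ) (a - b)), RCLike.norm_conj]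
        gcongr
    _ = _ := by ring

/-- uniqueness in `S^{-∞}(ℝ × [0,T] → ℂ)` for the generalized NLS equation. -/
theorem statement1 (μ : ℝ) (hμ : μ = 1 ∨ μ = -1) (T : ℝ) (hT : 0 < T)
    (f : ℝ → ℝ → ℂ) (hf : Smooth2 f)
    (hfdec : ∀ n : ℕ, ∃ C > (0 : ℝ), ∀ x : ℝ, ∀ t ∈ Set.Icc (0 : ℝ) T,
      ‖pd f 0 n x t‖ ≤ C * jb x ^ (-(n : ℝ)))
    (g : ℝ → ℝ → ℂ) (hg : SMinusInfOn g T)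
    (u v : ℝ → ℝ → ℂ)
    (hu : SMinusInfOn u T) (hv : SMinusInfOn v T)
    (hueq : GNLSEq μ f g u T) (hveq : GNLSEq μ f g v T)
    (hinit : ∀ x : ℝ, u x 0 = v x 0) :
    ∀ x : ℝ, ∀ t ∈ Set.Icc (0 : ℝ) T, u x t = v x t := by
  obtain ⟨Cf, hCf, bf⟩ := hfdec 0
  obtain ⟨u0, hu0, bu0⟩ := hu.2 2 0 0
  obtain ⟨u1, hu1, bu1⟩ := hu.2 0 0 1
  obtain ⟨u2, hu2, bu2⟩ := hu.2 0 0 2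
  obtain ⟨v0, hv0, bv0⟩ := hv.2 2 0 0
  obtain ⟨v1, hv1, bv1⟩ := hv.2 0 0 1
  obtain ⟨v2, hv2, bv2⟩ := hv.2 0 0 2
  simp only [jb_rpow_neg_two, jb_rpow_neg_zero, mul_one] at bf bu0 bu1 bu2 bv0 bv1 bv2
  have pd00 : ∀ (z : ℝ → ℝ → ℂ) (x t : ℝ), pd z 0 0 x t = z x t := fun z x t => by simp [pd]
  simp only [pd00] at bf bu0 bv0
  have decay_le : ∀ x : ℝ, (1 + x ^ 2)⁻¹ ≤ 1 := fun x =>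
    inv_le_one_of_one_le₀ (by nlinarith [sq_nonneg x])
  have hμn : ‖(μ : ℂ)‖ = 1 := by rcases hμ with rfl | rfl <;> simp
  set N : ℂ → ℂ → ℂ := fun w c => w ^ 2 * (starRingEnd ℂ) w + w ^ 2 * (starRingEnd ℂ) c
    + c ^ 2 * (starRingEnd ℂ) w + 2 * w * c * (starRingEnd ℂ) w
    + 2 * w * c * (starRingEnd ℂ) c with hN
  have cN : ∀ {z : ℝ → ℝ → ℂ}, Smooth2 z → ∀ t, Continuous fun x => N (z x t) (f x t) := by
    intro z hz t
    have h1 := (hz.slice_left 0 t).continuous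
    have h2 := (hf.slice_left 0 t).continuous
    have h3 := Complex.continuous_conj.comp h1
    have h4 := Complex.continuous_conj.comp h2
    simp only [Function.comp_def] at h3 h4
    simp only [hN]
    fun_prop
  have hx0 : ∀ {z : ℝ → ℝ → ℂ}, Smooth2 z → ∀ x t,
      HasDerivAt (fun y => z y t) (pd z 0 1 x t) x := by
    intro z hz x t
    simpa only [pd00] using hz.hasDerivAt_pd 0 x t
  set M : ℝ := Cf + u0 + v0 with hM
  set C : ℝ := (u0 + v0) + (u1 + v1) + (u2 + v2) with hC
  intro x t ht
  refine sub_eq_zero.1 (eq_zero_of_schrodinger_energy (T := T) (C := C) (K := 12 * M ^ 2)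
    (w := fun x t => u x t - v x t) (wx := fun x t => pd u 0 1 x t - pd v 0 1 x t)
    (wxx := fun x t => pd u 0 2 x t - pd v 0 2 x t)
    (h := fun x t => μ * (N (u x t) (f x t) - N (v x t) (f x t)))
    (fun x t _ => (hx0 hu.1 x t).sub (hx0 hv.1 x t))
    (fun x t _ => (hu.1.hasDerivAt_pd 1 x t).sub (hv.1.hasDerivAt_pd 1 x t))
    (fun x t ht => ?_)
    (fun t _ => continuous_iff_continuousAt.2 fun x =>
      ((hu.1.hasDerivAt_pd 2 x t).sub (hv.1.hasDerivAt_pd 2 x t)).continuousAt)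
    (fun t _ => continuous_const.mul ((cN hu.1 t).sub (cN hv.1 t)))
    (fun x t ht => ?_) (by positivity) (by positivity)
    (fun x t ht => ?_) (fun x t ht => ?_) (fun x t ht => ?_)
    (fun x => sub_eq_zero.2 (hinit x)) x t ht)
  · refine ((hu.1.hasDerivAt_time x t).sub (hv.1.hasDerivAt_time x t)).congr_deriv ?_
    have h1 := hueq x t ht
    have h2 := hveq x t ht
    linear_combination (norm := (simp only [hN]; ring_nf; simp only [Complex.I_sq]; ring))
      -Complex.I * (h1 - h2)
  · rw [norm_mul, hμn, one_mul]
    have b1 := (bu0 x t ht).trans (mul_le_of_le_one_right hu0.le (decay_le x))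
    have b2 := (bv0 x t ht).trans (mul_le_of_le_one_right hv0.le (decay_le x))
    have b3 := bf x t ht
    exact norm_nonlinearity_sub_le (by linarith) (by linarith) (by linarith)
  · have hle : u0 + v0 ≤ C := by linarith
    refine (norm_sub_le _ _).trans (le_trans ?_
      (mul_le_mul_of_nonneg_right hle (by positivity : 0 ≤ (1 + x ^ 2)⁻¹)))
    linarith [bu0 x t ht, bv0 x t ht]
  · exact (norm_sub_le _ _).trans (by linarith [bu1 x t ht, bv1 x t ht])
  · exact (norm_sub_le _ _).trans (by linarith [bu2 x t ht, bv2 x t ht])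
end
end

section
/- For every n ∈ ℕ there exists C_n > 0 such that for every h > 0 and every mesh function u : ℝ_h → ℝ with ‖u‖_{L²_h} < ∞, and every integer m with 0 ≤ m ≤ n, one has ‖D₊^m u‖_{L²_h} ≤ C_n ( ‖u‖_{L²_h} + ‖D₊^n u‖_{L²_h} ). -/
noncomputable section

/-- The forward difference operator with mesh size `h`, acting on mesh functions
(identified with functions `ℤ → ℝ` via `m ↦ u(mh)`). -/
def Dp (h : ℝ) (u : ℤ → ℝ) : ℤ → ℝ := fun m => (u (m + 1) - u m) / h

/-- The discrete `L²_h` norm `‖u‖_{L²_h} = √(Σ_m u(x_m)² h)`. -/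
def dnorm (h : ℝ) (u : ℤ → ℝ) : ℝ := Real.sqrt (∑' m : ℤ, u m ^ 2 * h)

theorem Summable.comp_add_one {f : ℤ → ℝ} (hf : Summable f) : Summable fun k => f (k + 1) :=
  (Equiv.addRight (1 : ℤ)).summable_iff.2 hf

theorem tsum_comp_add_one (f : ℤ → ℝ) : ∑' k, f (k + 1) = ∑' k, f k :=
  (Equiv.addRight (1 : ℤ)).tsum_eq f

/-- A mesh function stays square summable after a forward difference. -/
theorem summable_sq_Dp (h : ℝ) {v : ℤ → ℝ} (hv : Summable fun k => v k ^ 2) :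
    Summable fun k => Dp h v k ^ 2 := by
  have hv' : Summable fun k : ℤ => v (k + 1) ^ 2 := hv.comp_add_one
  refine Summable.of_nonneg_of_le (fun k => sq_nonneg _) (fun k => ?_)
    ((hv'.add hv).mul_left (2 / h ^ 2))
  have key : (v (k + 1) - v k) ^ 2 ≤ 2 * (v (k + 1) ^ 2 + v k ^ 2) := by
    nlinarith [sq_nonneg (v (k + 1) + v k)]
  calc Dp h v k ^ 2 = (v (k + 1) - v k) ^ 2 / h ^ 2 := by rw [Dp, div_pow]
    _ ≤ 2 * (v (k + 1) ^ 2 + v k ^ 2) / h ^ 2 := by gcongr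
    _ = 2 / h ^ 2 * (v (k + 1) ^ 2 + v k ^ 2) := by ring

theorem summable_sq_iterate_Dp (h : ℝ) {u : ℤ → ℝ} (hu : Summable fun k => u k ^ 2) (m : ℕ) :
    Summable fun k => (Dp h)^[m] u k ^ 2 := by
  induction m with
  | zero => exact hu
  | succ m ih =>
    simp only [Function.iterate_succ_apply']
    exact summable_sq_Dp h ih

theorem summable_mul_of_summable_sq {f g : ℤ → ℝ} (hf : Summable fun k => f k ^ 2)
    (hg : Summable fun k => g k ^ 2) : Summable fun k => f k * g k := by
  refine Summable.of_norm_bounded (hf.add hg) (fun k => ?_)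
  rw [Real.norm_eq_abs, abs_le]
  constructor <;> nlinarith [sq_nonneg (f k + g k), sq_nonneg (f k - g k)]

/-- Summation by parts for the forward difference. -/
theorem tsum_sq_Dp {h : ℝ} (hh : h ≠ 0) {v : ℤ → ℝ} (hv : Summable fun k => v k ^ 2) :
    ∑' k, Dp h v k ^ 2 = -∑' k, v (k + 1) * Dp h (Dp h v) k := by
  have hw := summable_sq_Dp h hv
  have hv' : Summable fun k : ℤ => v (k + 1) ^ 2 := hv.comp_add_one
  have hp := summable_mul_of_summable_sq hv hw
  have hp' : Summable fun k : ℤ => v (k + 1) * Dp h v (k + 1) := hp.comp_add_one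
  have hshift : ∑' k : ℤ, v (k + 1) * Dp h v (k + 1) = ∑' k, v k * Dp h v k :=
    tsum_comp_add_one fun k => v k * Dp h v k
  have hq := summable_mul_of_summable_sq hv' (summable_sq_Dp h hw)
  have hident : ∀ k, Dp h v k ^ 2 + v (k + 1) * Dp h (Dp h v) k =
      (v (k + 1) * Dp h v (k + 1) - v k * Dp h v k) / h := by
    intro k
    have hstep : v (k + 1) = v k + h * Dp h v k := by
      rw [Dp, mul_div_cancel₀ _ hh, add_sub_cancel]
    have hsnd : Dp h (Dp h v) k = (Dp h v (k + 1) - Dp h v k) / h := rfl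
    rw [hsnd, eq_div_iff hh, add_mul, mul_assoc, div_mul_cancel₀ _ hh]
    linear_combination -Dp h v k * hstep
  have hsum : ∑' k, Dp h v k ^ 2 + ∑' k, v (k + 1) * Dp h (Dp h v) k = 0 := by
    rw [← hw.tsum_add hq, tsum_congr hident, tsum_div_const, hp'.tsum_sub hp, hshift, sub_self,
      zero_div]
  exact eq_neg_of_add_eq_zero_left hsum

theorem two_mul_tsum_sq_Dp_le {h : ℝ} (hh : h ≠ 0) {v : ℤ → ℝ}
    (hv : Summable fun k => v k ^ 2) :
    2 * ∑' k, Dp h v k ^ 2 ≤ ∑' k, v k ^ 2 + ∑' k, Dp h (Dp h v) k ^ 2 := by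
  have hz := summable_sq_Dp h (summable_sq_Dp h hv)
  have hv' : Summable fun k : ℤ => v (k + 1) ^ 2 := hv.comp_add_one
  have hshift : ∑' k : ℤ, v (k + 1) ^ 2 = ∑' k, v k ^ 2 :=
    tsum_comp_add_one fun k => v k ^ 2
  have hq := summable_mul_of_summable_sq hv' hz
  rw [tsum_sq_Dp hh hv, ← hshift, ← hv'.tsum_add hz, ← tsum_neg, ← tsum_mul_left]
  refine (hq.neg.mul_left 2).tsum_le_tsum (fun k => ?_) (hv'.add hz)
  nlinarith [sq_nonneg (v (k + 1) + Dp h (Dp h v) k)]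

/-- A convex sequence is bounded on `{0, …, n}` by its values at the endpoints. -/
theorem le_max_of_two_mul_le_add {b : ℕ → ℝ} (hb : ∀ m, 2 * b (m + 1) ≤ b m + b (m + 2))
    {m n : ℕ} (hmn : m ≤ n) : b m ≤ max (b 0) (b n) := by
  induction n generalizing m with
  | zero => simp [Nat.le_zero.1 hmn]
  | succ n ih =>
    rcases hmn.eq_or_lt with rfl | hlt
    · exact le_max_right _ _
    have hn : b n ≤ max (b 0) (b (n + 1)) := by
      cases n with
      | zero => exact le_max_left _ _
      | succ k =>
        have hk := hb k
        rcases le_max_iff.1 (ih (Nat.le_succ k)) with h0 | h1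
        · rw [le_max_iff]
          by_contra! hcon
          linarith [hcon.1, hcon.2]
        · exact le_max_of_le_right (by linarith)
    exact (ih (Nat.lt_succ_iff.1 hlt)).trans (max_le (le_max_left _ _) hn)

/-- discrete interpolation inequality
`‖D₊^m u‖_{L²_h} ≤ C_n (‖u‖_{L²_h} + ‖D₊^n u‖_{L²_h})` for `0 ≤ m ≤ n`,
with `C_n` independent of `h` and `u`. -/
theorem statement4 (n : ℕ) :
    ∃ C > (0 : ℝ), ∀ h : ℝ, 0 < h → ∀ u : ℤ → ℝ,
      Summable (fun m : ℤ => u m ^ 2 * h) →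
      ∀ m : ℕ, m ≤ n →
        dnorm h ((Dp h)^[m] u) ≤ C * (dnorm h u + dnorm h ((Dp h)^[n] u)) := by
  refine ⟨1, one_pos, fun h hh u hu m hm => ?_⟩
  have hu' : Summable fun k => u k ^ 2 := (summable_mul_right_iff hh.ne').1 hu
  have hconv : ∀ j, 2 * ∑' k, (Dp h)^[j + 1] u k ^ 2 ≤
      ∑' k, (Dp h)^[j] u k ^ 2 + ∑' k, (Dp h)^[j + 2] u k ^ 2 := by
    intro j
    simp only [Function.iterate_succ_apply']
    exact two_mul_tsum_sq_Dp_le hh.ne' (summable_sq_iterate_Dp h hu' j)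
  have hmono : ∀ v w : ℤ → ℝ, ∑' k, v k ^ 2 ≤ ∑' k, w k ^ 2 → dnorm h v ≤ dnorm h w := by
    intro v w hvw
    simp only [dnorm, tsum_mul_right]
    gcongr
  have h0 : 0 ≤ dnorm h u := Real.sqrt_nonneg _
  have hn : 0 ≤ dnorm h ((Dp h)^[n] u) := Real.sqrt_nonneg _
  rw [one_mul]
  rcases le_max_iff.1 (le_max_of_two_mul_le_add
    (b := fun j => ∑' k, (Dp h)^[j] u k ^ 2) hconv hm) with hle | hle
  · exact (hmono _ u hle).trans (le_add_of_nonneg_right hn)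
  · exact (hmono _ _ hle).trans (le_add_of_nonneg_left h0)
end
end

section
/- For all N, j, l ∈ ℕ there exists C > 0 such that for every h ∈ (0,1) and every mesh function u : ℝ_h → ℝ one has ‖⟨x⟩^N D₊^j u‖_{L²_h} ≤ C ( ‖⟨x⟩^N u‖_{L²_h} + ‖⟨x⟩^N D₊^{j+l} u‖_{L²_h} ), where ⟨x⟩^N D₊^j u denotes the mesh function x_m ↦ ⟨x_m⟩^N (D₊^j u)(x_m). -/
noncomputable section

/-- The weighted mesh function `x_m ↦ ⟨x_m⟩^N u(x_m)`. -/
def wt (h : ℝ) (N : ℕ) (u : ℤ → ℝ) : ℤ → ℝ := fun m => jb ((m : ℝ) * h) ^ N * u m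

open MeasureTheory Finset
open scoped NNReal ENNReal

/-- The weighted `ℓ²` norm of a mesh function, valued in `[0, ∞]` (without the factor `√h`). -/
def weightedNorm (h : ℝ) (N : ℕ) (f : ℤ → ℝ) : ℝ≥0∞ := eLpNorm (wt h N f) 2 Measure.count

/-- The average of a mesh function over `r` consecutive mesh points. -/
def avg (r : ℕ) (f : ℤ → ℝ) : ℤ → ℝ := fun m => (r : ℝ)⁻¹ * ∑ i ∈ range r, f (m + i)

lemma jb_nonneg (x : ℝ) : 0 ≤ jb x := Real.sqrt_nonneg _

lemma jb_le_three_mul {x a : ℝ} (ha : 0 ≤ a) (ha' : a ≤ 2) : jb x ≤ 3 * jb (x + a) := by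
  unfold jb
  rw [Real.sqrt_le_left (by positivity), mul_pow, Real.sq_sqrt (by positivity)]
  nlinarith [sq_nonneg (x + 2 * a), sq_nonneg (x + a)]

section weightedNorm

variable {h : ℝ} {N : ℕ} {f g : ℤ → ℝ}

lemma weightedNorm_mono (hfg : ∀ m, |f m| ≤ |g m|) : weightedNorm h N f ≤ weightedNorm h N g := by
  refine eLpNorm_mono fun m => ?_
  simp only [wt, norm_mul, Real.norm_eq_abs]
  exact mul_le_mul_of_nonneg_left (hfg m) (abs_nonneg _)

lemma weightedNorm_abs : weightedNorm h N (fun m => |f m|) ≤ weightedNorm h N f :=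
  weightedNorm_mono fun _ => (abs_abs _).le

lemma weightedNorm_const_mul (c : ℝ≥0) :
    weightedNorm h N (fun m => c * f m) = c * weightedNorm h N f := by
  have : wt h N (fun m => c * f m) = (c : ℝ) • wt h N f := by
    ext m; simp only [wt, Pi.smul_apply, smul_eq_mul]; ring
  rw [weightedNorm, this, eLpNorm_const_smul]
  simp [weightedNorm]

lemma weightedNorm_add_le :
    weightedNorm h N (fun m => f m + g m) ≤ weightedNorm h N f + weightedNorm h N g := by
  have : wt h N (fun m => f m + g m) = wt h N f + wt h N g := by
    ext m; simp only [wt, Pi.add_apply]; ring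
  rw [weightedNorm, this]
  exact eLpNorm_add_le (measurable_of_countable _).aestronglyMeasurable
    (measurable_of_countable _).aestronglyMeasurable (by norm_num)

lemma weightedNorm_sum_le {ι : Type*} (s : Finset ι) (F : ι → ℤ → ℝ) :
    weightedNorm h N (fun m => ∑ i ∈ s, F i m) ≤ ∑ i ∈ s, weightedNorm h N (F i) := by
  have : wt h N (fun m => ∑ i ∈ s, F i m) = ∑ i ∈ s, wt h N (F i) := by
    ext m; simp only [wt, Finset.sum_apply, mul_sum]
  rw [weightedNorm, this]
  exact eLpNorm_sum_le (fun i _ => (measurable_of_countable _).aestronglyMeasurable) (by norm_num)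

lemma weightedNorm_shift_le (hh : 0 ≤ h) {k : ℕ} (hk : k * h ≤ 2) :
    weightedNorm h N (fun m => f (m + k)) ≤ (3 ^ N : ℝ≥0) * weightedNorm h N f := by
  have hmp : MeasurePreserving (fun m : ℤ => m + k) Measure.count Measure.count :=
    measurePreserving_add_right _ _
  have hcomp : eLpNorm (wt h N f ∘ fun m : ℤ => m + k) 2 Measure.count = weightedNorm h N f :=
    eLpNorm_comp_measurePreserving (measurable_of_countable _).aestronglyMeasurable hmp
  rw [← hcomp]
  refine eLpNorm_le_nnreal_smul_eLpNorm_of_ae_le_mul (.of_forall fun m => ?_) 2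
  rw [← NNReal.coe_le_coe]
  simp only [wt, Function.comp_apply, coe_nnnorm, NNReal.coe_mul, norm_mul, norm_pow,
    Real.norm_eq_abs, abs_of_nonneg (jb_nonneg _), ← mul_assoc, NNReal.coe_pow,
    NNReal.coe_ofNat, ← mul_pow]
  gcongr
  · exact jb_nonneg _
  · push_cast
    rw [add_mul]
    exact jb_le_three_mul (by positivity) hk

lemma weightedNorm_avg_le (hh : 0 ≤ h) {r : ℕ} (hr : r ≠ 0) (hrh : r * h ≤ 2) :
    weightedNorm h N (avg r f) ≤ (3 ^ N : ℝ≥0) * weightedNorm h N f := by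
  have h1 := weightedNorm_const_mul (h := h) (N := N) (f := fun m => ∑ i ∈ range r, f (m + i))
    ((r : ℝ≥0)⁻¹)
  have h2 : weightedNorm h N (fun m => ∑ i ∈ range r, f (m + i)) ≤
      r * ((3 ^ N : ℝ≥0) * weightedNorm h N f) := by
    refine (weightedNorm_sum_le (range r) fun i m => f (m + i)).trans ?_
    refine (sum_le_card_nsmul _ _ _ fun i hi => weightedNorm_shift_le hh ?_).trans ?_
    · exact le_trans (by gcongr; exact (mem_range.1 hi).le) hrh
    · simp
  calc weightedNorm h N (avg r f)
      = ((r : ℝ≥0)⁻¹ : ℝ≥0) * weightedNorm h N (fun m => ∑ i ∈ range r, f (m + i)) := by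
        rw [← h1]; simp only [NNReal.coe_inv, NNReal.coe_natCast]; rfl
    _ ≤ ((r : ℝ≥0)⁻¹ : ℝ≥0) * (r * ((3 ^ N : ℝ≥0) * weightedNorm h N f)) := by gcongr
    _ = (3 ^ N : ℝ≥0) * weightedNorm h N f := by
        rw [← mul_assoc, ← ENNReal.coe_natCast r, ← ENNReal.coe_mul,
          inv_mul_cancel₀ (by exact_mod_cast hr), ENNReal.coe_one, one_mul]

lemma abs_sub_shift_le (hh : 0 < h) {i r : ℕ} (hi : i ≤ r) (m : ℤ) :
    |f m - f (m + i)| ≤ h * ∑ k ∈ range r, |Dp h f (m + k)| := by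
  have key : f m - f (m + i) = -(h * ∑ k ∈ range i, Dp h f (m + k)) := by
    have := sum_range_sub (fun k : ℕ => f (m + k)) i
    simp only [Nat.cast_zero, add_zero] at this
    rw [← neg_sub, ← this, mul_sum]
    congr 1
    refine sum_congr rfl fun k _ => ?_
    simp only [Dp]
    rw [mul_div_cancel₀ _ hh.ne']
    push_cast
    rw [add_assoc]
  rw [key, abs_neg, abs_mul, abs_of_pos hh]
  refine mul_le_mul_of_nonneg_left ((abs_sum_le_sum_abs _ _).trans ?_) hh.le
  exact sum_le_sum_of_subset_of_nonneg (range_subset_range.2 hi) fun _ _ _ => abs_nonneg _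

lemma abs_sub_avg_le (hh : 0 < h) {r : ℕ} (hr : r ≠ 0) (m : ℤ) :
    |f m - avg r f m| ≤ r * h * avg r (fun m => |Dp h f m|) m := by
  have hr0 : (0 : ℝ) < r := by exact_mod_cast Nat.pos_of_ne_zero hr
  have key : f m - avg r f m = (r : ℝ)⁻¹ * ∑ i ∈ range r, (f m - f (m + i)) := by
    simp only [avg, sum_sub_distrib, sum_const, card_range, nsmul_eq_mul]
    field_simp
  rw [key, abs_mul, abs_of_pos (inv_pos.2 hr0)]
  calc (r : ℝ)⁻¹ * |∑ i ∈ range r, (f m - f (m + i))|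
      ≤ (r : ℝ)⁻¹ * ∑ _i ∈ range r, (h * ∑ k ∈ range r, |Dp h f (m + k)|) := by
        gcongr
        refine (abs_sum_le_sum_abs _ _).trans (sum_le_sum fun i hi => ?_)
        exact abs_sub_shift_le hh (mem_range.1 hi).le m
    _ = _ := by
        simp only [avg, sum_const, card_range, nsmul_eq_mul]
        field_simp

lemma weightedNorm_sub_avg_le (hh : 0 < h) {r : ℕ} (hr : r ≠ 0) (hrh : r * h ≤ 2) :
    weightedNorm h N (fun m => f m - avg r f m) ≤
      (2 * 3 ^ N : ℝ≥0) * weightedNorm h N (Dp h f) := by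
  calc weightedNorm h N (fun m => f m - avg r f m)
      ≤ weightedNorm h N (fun m => (2 : ℝ≥0) * avg r (fun m => |Dp h f m|) m) := by
        refine weightedNorm_mono fun m => ((abs_sub_avg_le hh hr m).trans ?_).trans (le_abs_self _)
        have : 0 ≤ avg r (fun m => |Dp h f m|) m :=
          mul_nonneg (by positivity) (sum_nonneg fun _ _ => abs_nonneg _)
        exact mul_le_mul_of_nonneg_right hrh this
    _ = (2 : ℝ≥0) * weightedNorm h N (avg r (fun m => |Dp h f m|)) := weightedNorm_const_mul _
    _ ≤ (2 : ℝ≥0) * ((3 ^ N : ℝ≥0) * weightedNorm h N (Dp h f)) := by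
        gcongr
        exact (weightedNorm_avg_le hh.le hr hrh).trans (by gcongr; exact weightedNorm_abs)
    _ = _ := by rw [← mul_assoc, ← ENNReal.coe_mul]

lemma avg_Dp (r : ℕ) (m : ℤ) :
    avg r (Dp h f) m = (r * h)⁻¹ * (f (m + r) - f m) := by
  have := sum_range_sub (fun k : ℕ => f (m + k)) r
  simp only [Nat.cast_zero, add_zero] at this
  rw [← this, avg, mul_inv, mul_assoc, mul_sum _ _ h⁻¹]
  congr 1
  refine sum_congr rfl fun k _ => ?_
  simp only [Dp, Nat.cast_add, Nat.cast_one, add_assoc]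
  rw [div_eq_inv_mul]

lemma commute_avg_Dp (r : ℕ) : Function.Commute (avg r) (Dp h) := fun f => by
  ext m
  simp only [avg, Dp, ← mul_sub, ← sum_sub_distrib, mul_div_assoc, sum_div]
  congr 1
  refine sum_congr rfl fun i _ => ?_
  rw [add_right_comm]

lemma weightedNorm_avg_Dp_le (hh : 0 < h) {r : ℕ} (hr1 : 1 ≤ r * h) (hrh : r * h ≤ 2) :
    weightedNorm h N (avg r (Dp h f)) ≤ (3 ^ N + 1 : ℝ≥0) * weightedNorm h N f := by
  calc weightedNorm h N (avg r (Dp h f))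
      ≤ weightedNorm h N (fun m => |f (m + r)| + |f m|) := by
        refine weightedNorm_mono fun m => ?_
        rw [avg_Dp, abs_mul, abs_of_nonneg (by positivity : (0 : ℝ) ≤ (r * h)⁻¹)]
        refine (mul_le_of_le_one_left (abs_nonneg _) (inv_le_one_of_one_le₀ hr1)).trans ?_
        exact (abs_sub _ _).trans (le_abs_self _)
    _ ≤ weightedNorm h N (fun m => f (m + r)) + weightedNorm h N f :=
        weightedNorm_add_le.trans (add_le_add weightedNorm_abs weightedNorm_abs)
    _ ≤ (3 ^ N : ℝ≥0) * weightedNorm h N f + weightedNorm h N f := by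
        gcongr; exact weightedNorm_shift_le hh.le hrh
    _ = _ := by rw [ENNReal.coe_add, add_mul, ENNReal.coe_one, one_mul]

end weightedNorm

lemma iterate_le_pow_mul {α : Type*} {W : α → ℝ≥0∞} {T : α → α} {K : ℝ≥0∞}
    (hT : ∀ f, W (T f) ≤ K * W f) (n : ℕ) (f : α) : W (T^[n] f) ≤ K ^ n * W f := by
  induction n with
  | zero => simp
  | succ n ih =>
    rw [Function.iterate_succ_apply', pow_succ', mul_assoc]
    exact (hT _).trans (by gcongr)

lemma weightedNorm_le_avg_iterate (N a : ℕ) :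
    ∃ C : ℝ≥0, ∀ h : ℝ, 0 < h → ∀ r : ℕ, r ≠ 0 → r * h ≤ 2 → ∀ f : ℤ → ℝ,
      weightedNorm h N f ≤ weightedNorm h N ((avg r)^[a] f) + C * weightedNorm h N (Dp h f) := by
  induction a with
  | zero => exact ⟨0, by simp⟩
  | succ a ih =>
    obtain ⟨C, hC⟩ := ih
    refine ⟨2 * 3 ^ N * (3 ^ N) ^ a + C, fun h hh r hr hrh f => (hC h hh r hr hrh f).trans ?_⟩
    set g := (avg r)^[a] f with hg
    have h1 : weightedNorm h N g ≤ weightedNorm h N (avg r g) +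
        (2 * 3 ^ N : ℝ≥0) * weightedNorm h N (Dp h g) := by
      calc weightedNorm h N g = weightedNorm h N (fun m => avg r g m + (g m - avg r g m)) := by
            congr 1; ext m; ring
        _ ≤ _ := weightedNorm_add_le.trans (by gcongr; exact weightedNorm_sub_avg_le hh hr hrh)
    have h2 : weightedNorm h N (Dp h g) ≤
        ((3 ^ N : ℝ≥0) : ℝ≥0∞) ^ a * weightedNorm h N (Dp h f) := by
      rw [hg, ← ((commute_avg_Dp r).iterate_left a).eq f]
      exact iterate_le_pow_mul (fun f => weightedNorm_avg_le hh.le hr hrh) a _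
    rw [Function.iterate_succ_apply', ← hg, ENNReal.coe_add, add_mul, ← add_assoc]
    gcongr
    refine h1.trans ?_
    rw [ENNReal.coe_mul _ ((3 ^ N) ^ a), ENNReal.coe_pow, mul_assoc]
    gcongr

lemma exists_mul_mem_Icc {h : ℝ} (hh : h ∈ Set.Ioo (0 : ℝ) 1) :
    ∃ r : ℕ, r ≠ 0 ∧ 1 ≤ r * h ∧ r * h ≤ 2 := by
  have hpos := inv_pos.2 hh.1
  refine ⟨⌈h⁻¹⌉₊, (Nat.ceil_pos.2 hpos).ne', ?_, ?_⟩
  · simpa [hh.1.ne'] using mul_le_mul_of_nonneg_right (Nat.le_ceil h⁻¹) hh.1.le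
  · have := mul_le_mul_of_nonneg_right (Nat.ceil_lt_add_one hpos.le).le hh.1.le
    rw [add_mul, inv_mul_cancel₀ hh.1.ne'] at this
    linarith [hh.2]

lemma weightedNorm_iterate_le_succ (N j : ℕ) :
    ∃ C : ℝ≥0, ∀ h ∈ Set.Ioo (0 : ℝ) 1, ∀ u : ℤ → ℝ,
      weightedNorm h N ((Dp h)^[j] u) ≤
        C * (weightedNorm h N u + weightedNorm h N ((Dp h)^[j + 1] u)) := by
  obtain ⟨C, hC⟩ := weightedNorm_le_avg_iterate N j
  refine ⟨(3 ^ N + 1) ^ j + C, fun h hh u => ?_⟩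
  obtain ⟨r, hr, hr1, hr2⟩ := exists_mul_mem_Icc hh
  refine (hC h hh.1 r hr hr2 _).trans ?_
  have havg : (avg r)^[j] ((Dp h)^[j] u) = (avg r ∘ Dp h)^[j] u :=
    (congrFun ((commute_avg_Dp r).comp_iterate j) u).symm
  have hpow := iterate_le_pow_mul (W := weightedNorm h N) (T := avg r ∘ Dp h)
    (fun f => weightedNorm_avg_Dp_le hh.1 hr1 hr2) j u
  rw [← Function.iterate_succ_apply' (Dp h), havg, ENNReal.coe_add, ENNReal.coe_pow, mul_add]
  gcongr
  · exact hpow.trans (by gcongr; exact le_self_add)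
  · exact le_add_self

lemma weightedNorm_iterate_le (N j l : ℕ) :
    ∃ C : ℝ≥0, ∀ h ∈ Set.Ioo (0 : ℝ) 1, ∀ u : ℤ → ℝ,
      weightedNorm h N ((Dp h)^[j] u) ≤
        C * (weightedNorm h N u + weightedNorm h N ((Dp h)^[j + l] u)) := by
  induction l with
  | zero => exact ⟨1, fun h _ u => by simp⟩
  | succ l ih =>
    obtain ⟨A, hA⟩ := ih
    obtain ⟨B, hB⟩ := weightedNorm_iterate_le_succ N (j + l)
    refine ⟨A * (1 + B), fun h hh u => (hA h hh u).trans ?_⟩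
    rw [ENNReal.coe_mul, mul_assoc]
    gcongr
    rw [ENNReal.coe_add, ENNReal.coe_one, add_mul, one_mul]
    exact add_le_add le_self_add (hB h hh u)

lemma summable_sq_mul_iff {h : ℝ} (hh : 0 < h) (f : ℤ → ℝ) :
    Summable (fun m => f m ^ 2 * h) ↔ eLpNorm f 2 Measure.count ≠ ∞ := by
  rw [summable_mul_right_iff hh.ne', ← lt_top_iff_ne_top,
    eLpNorm_lt_top_iff_lintegral_rpow_enorm_lt_top (by norm_num) (by norm_num), lintegral_count,
    lt_top_iff_ne_top]
  have : ∀ m, ‖f m‖ₑ ^ (2 : ℝ≥0∞).toReal = ENNReal.ofReal (f m ^ 2) := fun m => by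
    rw [← ofReal_norm, ENNReal.toReal_ofNat, ENNReal.rpow_ofNat,
      ← ENNReal.ofReal_pow (norm_nonneg _), Real.norm_eq_abs, sq_abs]
  simp only [this]
  exact ⟨fun hs => hs.tsum_ofReal_ne_top, fun hs => by
    simpa [ENNReal.toReal_ofReal, sq_nonneg] using ENNReal.summable_toReal hs⟩

lemma dnorm_eq {h : ℝ} (hh : 0 < h) (f : ℤ → ℝ) :
    dnorm h f = √h * (eLpNorm f 2 Measure.count).toReal := by
  rw [dnorm, tsum_mul_right, mul_comm, Real.sqrt_mul hh.le,
    eLpNorm_eq_lintegral_rpow_enorm_toReal (by norm_num) (by norm_num), lintegral_count,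
    ← ENNReal.toReal_rpow, ENNReal.tsum_toReal_eq (by simp), Real.sqrt_eq_rpow (∑' m, f m ^ 2)]
  simp

/-- weighted discrete interpolation inequality
`‖⟨x⟩^N D₊^j u‖_{L²_h} ≤ C (‖⟨x⟩^N u‖_{L²_h} + ‖⟨x⟩^N D₊^{j+l} u‖_{L²_h})`,
with `C` independent of `h ∈ (0,1)` and `u`, whenever the right-hand side is finite. -/
theorem statement6 (N j l : ℕ) :
    ∃ C > (0 : ℝ), ∀ h ∈ Set.Ioo (0 : ℝ) 1, ∀ u : ℤ → ℝ,
      Summable (fun m : ℤ => wt h N u m ^ 2 * h) →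
      Summable (fun m : ℤ => wt h N ((Dp h)^[j + l] u) m ^ 2 * h) →
      Summable (fun m : ℤ => wt h N ((Dp h)^[j] u) m ^ 2 * h) ∧
        dnorm h (wt h N ((Dp h)^[j] u))
          ≤ C * (dnorm h (wt h N u) + dnorm h (wt h N ((Dp h)^[j + l] u))) := by
  obtain ⟨C, hC⟩ := weightedNorm_iterate_le N j l
  refine ⟨C + 1, by positivity, fun h hh u hu hv => ?_⟩
  have hle := hC h hh u
  rw [summable_sq_mul_iff hh.1, ← weightedNorm] at hu hv ⊢
  simp only [dnorm_eq hh.1, ← mul_add]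
  change _ ∧ √h * (weightedNorm h N _).toReal ≤
    _ * (√h * ((weightedNorm h N _).toReal + (weightedNorm h N _).toReal))
  have hfin : (C : ℝ≥0∞) * (weightedNorm h N u + weightedNorm h N ((Dp h)^[j + l] u)) ≠ ∞ :=
    ENNReal.mul_ne_top ENNReal.coe_ne_top (ENNReal.add_ne_top.2 ⟨hu, hv⟩)
  refine ⟨ne_top_of_le_ne_top hfin hle, ?_⟩
  have hreal := ENNReal.toReal_mono hfin hle
  rw [ENNReal.toReal_mul, ENNReal.toReal_add hu hv, ENNReal.coe_toReal] at hreal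
  rw [mul_left_comm]
  refine mul_le_mul_of_nonneg_left (hreal.trans ?_) (Real.sqrt_nonneg h)
  exact mul_le_mul_of_nonneg_right (by linarith) (by positivity)
end
end

section
/- For all N, j ∈ ℕ and every integer l ≥ 1 there exists C > 0 such that for every h ∈ (0,1) and every mesh function u : ℝ_h → ℝ one has sup_{x ∈ ℝ_h} |⟨x⟩^N (D₊^j u)(x)| ≤ C ( ‖⟨x⟩^N u‖_{L²_h} + ‖⟨x⟩^N D₊^{j+l} u‖_{L²_h} ), where ⟨x⟩^N D₊^{j+l} u denotes the mesh function x_m ↦ ⟨x_m⟩^N (D₊^{j+l} u)(x_m). -/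
noncomputable section

/-- The mass `h Σ_{p < M} |f(m + p)|` of a mesh function on the window of `M` points starting
at `m`. -/
def windowMass (h : ℝ) (M : ℕ) (f : ℤ → ℝ) (m : ℤ) : ℝ := h * ∑ p ∈ Finset.range M, |f (m + p)|

/-- The difference quotient with the coarse step `n h`. -/
def coarseDiff (h : ℝ) (n : ℕ) (u : ℤ → ℝ) : ℤ → ℝ := fun m => (u (m + n) - u m) / (n * h)

lemma windowMass_shift_le {h : ℝ} (hh : 0 ≤ h) {M M' p : ℕ} (hM : M + p ≤ M') (f : ℤ → ℝ)
    (m : ℤ) : windowMass h M f (m + p) ≤ windowMass h M' f m := by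
  unfold windowMass
  refine mul_le_mul_of_nonneg_left ?_ hh
  calc ∑ q ∈ Finset.range M, |f (m + p + q)|
      = ∑ q ∈ (Finset.range M).image (fun q => q + p), |f (m + q)| := by
        rw [Finset.sum_image (by intro a _ b _ hab; simpa using hab)]
        refine Finset.sum_congr rfl fun q _ => ?_
        congr 2
        push_cast
        ring
    _ ≤ ∑ q ∈ Finset.range M', |f (m + q)| := by
        refine Finset.sum_le_sum_of_subset_of_nonneg ?_ fun _ _ _ => abs_nonneg _
        intro q hq
        simp only [Finset.mem_image, Finset.mem_range] at hq ⊢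
        omega

lemma windowMass_mono {h : ℝ} (hh : 0 ≤ h) {M M' : ℕ} (hM : M ≤ M') (f : ℤ → ℝ) (m : ℤ) :
    windowMass h M f m ≤ windowMass h M' f m := by
  simpa using windowMass_shift_le hh (p := 0) (by simpa using hM) f m

lemma windowMass_nonneg {h : ℝ} (hh : 0 ≤ h) (M : ℕ) (f : ℤ → ℝ) (m : ℤ) :
    0 ≤ windowMass h M f m :=
  mul_nonneg hh (Finset.sum_nonneg fun _ _ => abs_nonneg _)

lemma windowMass_le_of_forall_le {h : ℝ} (hh : 0 ≤ h) {M : ℕ} {f : ℤ → ℝ} {m : ℤ} {B : ℝ}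
    (hB : ∀ p < M, |f (m + p)| ≤ B) : windowMass h M f m ≤ M * h * B := by
  have h1 : ∑ p ∈ Finset.range M, |f (m + p)| ≤ ∑ _p ∈ Finset.range M, B :=
    Finset.sum_le_sum fun p hp => hB p (Finset.mem_range.1 hp)
  rw [Finset.sum_const, Finset.card_range, nsmul_eq_mul] at h1
  calc windowMass h M f m ≤ h * (M * B) := mul_le_mul_of_nonneg_left h1 hh
    _ = M * h * B := by ring

lemma Dp_iterate_coarseDiff (h : ℝ) (n k : ℕ) (u : ℤ → ℝ) :
    (Dp h)^[k] (coarseDiff h n u) = coarseDiff h n ((Dp h)^[k] u) := by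
  have hc : Function.Commute (Dp h) (coarseDiff h n) := by
    intro v
    funext m
    simp only [Dp, coarseDiff]
    rw [show m + 1 + (n : ℤ) = m + n + 1 by ring]
    ring
  exact (hc.iterate_left k) u

lemma sum_Dp {h : ℝ} (hh : 0 < h) (f : ℤ → ℝ) (m : ℤ) (p : ℕ) :
    h * ∑ q ∈ Finset.range p, Dp h f (m + q) = f (m + p) - f m := by
  induction p with
  | zero => simp
  | succ p ih =>
    rw [Finset.sum_range_succ, mul_add, ih, Dp]
    push_cast
    rw [mul_div_cancel₀ _ hh.ne', add_assoc m]
    ring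

lemma abs_sub_le_windowMass {h : ℝ} (hh : 0 < h) (f : ℤ → ℝ) (m : ℤ) {p n : ℕ} (hp : p ≤ n) :
    |f (m + p) - f m| ≤ windowMass h n (Dp h f) m := by
  refine le_trans ?_ (windowMass_mono hh.le hp _ _)
  rw [← sum_Dp hh, abs_mul, abs_of_pos hh]
  exact mul_le_mul_of_nonneg_left (Finset.abs_sum_le_sum_abs _ _) hh.le

lemma coarseDiff_eq_average {h : ℝ} (hh : 0 < h) (n : ℕ) (f : ℤ → ℝ) (m : ℤ) :
    coarseDiff h n f m = (∑ p ∈ Finset.range n, Dp h f (m + p)) / n := by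
  rw [coarseDiff, ← sum_Dp hh, mul_comm (n : ℝ) h, mul_div_mul_left _ _ hh.ne']

lemma abs_average_sub_le {n : ℕ} (hn : 0 < n) (f : ℤ → ℝ) (m : ℤ) {B : ℝ}
    (hB : ∀ p < n, |f (m + p) - f m| ≤ B) :
    |(∑ p ∈ Finset.range n, f (m + p)) / n - f m| ≤ B := by
  have hn' : (0 : ℝ) < n := by exact_mod_cast hn
  have h1 : (∑ p ∈ Finset.range n, f (m + p)) / n - f m
      = (∑ p ∈ Finset.range n, (f (m + p) - f m)) / n := by
    rw [Finset.sum_sub_distrib, Finset.sum_const, Finset.card_range, nsmul_eq_mul]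
    field_simp
  rw [h1, abs_div, abs_of_pos hn', div_le_iff₀ hn']
  refine (Finset.abs_sum_le_sum_abs _ _).trans ?_
  refine (Finset.sum_le_sum fun p hp => hB p (Finset.mem_range.1 hp)).trans ?_
  rw [Finset.sum_const, Finset.card_range, nsmul_eq_mul, mul_comm]

lemma abs_average_le_windowMass {h : ℝ} {n : ℕ} (hn : 0 < n) (hnh : 1 ≤ n * h) (f : ℤ → ℝ)
    (m : ℤ) : |(∑ p ∈ Finset.range n, f (m + p)) / n| ≤ windowMass h n f m := by
  have hn' : (0 : ℝ) < n := by exact_mod_cast hn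
  rw [abs_div, abs_of_pos hn', div_le_iff₀ hn', windowMass]
  refine (Finset.abs_sum_le_sum_abs _ _).trans ?_
  have h1 : 0 ≤ ∑ p ∈ Finset.range n, |f (m + p)| := Finset.sum_nonneg fun _ _ => abs_nonneg _
  nlinarith

lemma windowMass_coarseDiff_le {h : ℝ} (hh : 0 < h) {n : ℕ} (hnh : 1 ≤ n * h) (M : ℕ)
    (u : ℤ → ℝ) (m : ℤ) :
    windowMass h M (coarseDiff h n u) m ≤ 2 * windowMass h (M + n) u m := by
  have h1 : windowMass h M (coarseDiff h n u) m
      ≤ windowMass h M u (m + n) + windowMass h M u m := by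
    unfold windowMass
    rw [← mul_add, ← Finset.sum_add_distrib]
    refine mul_le_mul_of_nonneg_left (Finset.sum_le_sum fun p _ => ?_) hh.le
    rw [coarseDiff, abs_div, abs_of_pos (lt_of_lt_of_le one_pos hnh)]
    refine (div_le_self (abs_nonneg _) hnh).trans ((abs_sub _ _).trans (le_of_eq ?_))
    rw [add_right_comm]
  have h2 := windowMass_shift_le hh.le (le_refl (M + n)) u m
  have h3 := windowMass_mono hh.le (Nat.le_add_right M n) u m
  linarith

/-- Local Sobolev inequality with one extra difference, uniform in the mesh size. -/
lemma exists_abs_Dp_iterate_le (k : ℕ) : ∃ C ≥ (0 : ℝ), ∃ R : ℕ, ∀ (h : ℝ) (n : ℕ), 0 < h →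
    1 ≤ n * h → n * h ≤ 2 → ∀ (u : ℤ → ℝ) (m : ℤ), |(Dp h)^[k] u m|
      ≤ C * (windowMass h (R * n) u m + windowMass h (R * n) ((Dp h)^[k + 1] u) m) := by
  induction k with
  | zero =>
    refine ⟨1, zero_le_one, 1, fun h n hh hnh _ u m => ?_⟩
    have hn : 0 < n := by
      rcases Nat.eq_zero_or_pos n with rfl | hn
      · norm_num at hnh
      · exact hn
    have h1 := abs_average_sub_le hn u m fun p hp => abs_sub_le_windowMass hh u m hp.le
    have h2 := abs_average_le_windowMass hn hnh u m
    simp only [one_mul, Function.iterate_zero, id_eq, zero_add, Function.iterate_one]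
    rw [abs_le] at *
    constructor <;> linarith [h1.1, h1.2, h2.1, h2.2]
  | succ k ih =>
    obtain ⟨C, hC, R, ih⟩ := ih
    refine ⟨1 + 2 * C + 2 * R * C, by positivity, R + 1, fun h n hh hnh hnh2 u m => ?_⟩
    have hn : 0 < n := by
      rcases Nat.eq_zero_or_pos n with rfl | hn
      · norm_num at hnh
      · exact hn
    have hRn : (R + 1) * n = R * n + n := by ring
    have key := ih h n hh hnh hnh2 (coarseDiff h n u) m
    rw [Dp_iterate_coarseDiff, Dp_iterate_coarseDiff, coarseDiff_eq_average hh,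
      ← Function.iterate_succ_apply' (Dp h)] at key
    have h1 := abs_average_sub_le hn ((Dp h)^[k + 1] u) m
      fun p hp => abs_sub_le_windowMass hh _ m hp.le
    rw [← Function.iterate_succ_apply' (Dp h)] at h1
    have h2 := windowMass_coarseDiff_le hh hnh (R * n) u m
    have h3 : windowMass h (R * n) (coarseDiff h n ((Dp h)^[k + 1] u)) m
        ≤ ↑(R * n) * h * windowMass h (R * n + n) ((Dp h)^[k + 1 + 1] u) m := by
      refine windowMass_le_of_forall_le hh.le fun p hp => ?_
      rw [coarseDiff_eq_average hh, ← Function.iterate_succ_apply' (Dp h)]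
      exact (abs_average_le_windowMass hn hnh _ _).trans
        (windowMass_shift_le hh.le (by omega) _ _)
    rw [hRn]
    set U := windowMass h (R * n + n) u m
    set V := windowMass h (R * n + n) ((Dp h)^[k + 1 + 1] u) m
    have hU : 0 ≤ U := windowMass_nonneg hh.le _ _ _
    have hV : 0 ≤ V := windowMass_nonneg hh.le _ _ _
    have h4 : windowMass h n ((Dp h)^[k + 1 + 1] u) m ≤ V :=
      windowMass_mono hh.le (Nat.le_add_left _ _) _ _
    have h5 : ↑(R * n) * h * V ≤ 2 * R * V := by
      refine mul_le_mul_of_nonneg_right ?_ hV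
      push_cast
      nlinarith [(Nat.cast_nonneg R : (0 : ℝ) ≤ R)]
    have h6 := key.trans (mul_le_mul_of_nonneg_left (add_le_add h2 (h3.trans h5)) hC)
    have h7 : |(Dp h)^[k + 1] u m| ≤ V + C * (2 * U + 2 * R * V) := by
      have h8 := h1.trans h4
      rw [abs_le] at *
      constructor <;> linarith [h8.1, h8.2, h6.1, h6.2]
    have hR : (0 : ℝ) ≤ R := Nat.cast_nonneg R
    have : 0 ≤ U + 2 * R * C * U + 2 * C * V := by positivity
    linarith

/-- Local Sobolev inequality with `l + 1` extra differences, uniform in the mesh size. -/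
lemma exists_abs_Dp_iterate_le_add (j l : ℕ) : ∃ C ≥ (0 : ℝ), ∃ R : ℕ, ∀ (h : ℝ) (n : ℕ), 0 < h →
    1 ≤ n * h → n * h ≤ 2 → ∀ (u : ℤ → ℝ) (m : ℤ), |(Dp h)^[j] u m|
      ≤ C * (windowMass h (R * n) u m + windowMass h (R * n) ((Dp h)^[j + (l + 1)] u) m) := by
  induction l with
  | zero => exact exists_abs_Dp_iterate_le j
  | succ l ih =>
    obtain ⟨C, hC, R, ih⟩ := ih
    obtain ⟨C', hC', R', hstep⟩ := exists_abs_Dp_iterate_le (j + (l + 1))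
    refine ⟨C * (1 + 2 * R * C'), by positivity, R + R', fun h n hh hnh hnh2 u m => ?_⟩
    have hRn : (R + R') * n = R * n + R' * n := by ring
    rw [hRn]
    set U := windowMass h (R * n + R' * n) u m
    set V := windowMass h (R * n + R' * n) ((Dp h)^[j + (l + 1 + 1)] u) m
    have hU : 0 ≤ U := windowMass_nonneg hh.le _ _ _
    have hV : 0 ≤ V := windowMass_nonneg hh.le _ _ _
    have h2 : windowMass h (R * n) u m ≤ U := windowMass_mono hh.le (Nat.le_add_right _ _) _ _
    have h3 : windowMass h (R * n) ((Dp h)^[j + (l + 1)] u) m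
        ≤ ↑(R * n) * h * (C' * (U + V)) := by
      refine windowMass_le_of_forall_le hh.le fun p hp => ?_
      refine (hstep h n hh hnh hnh2 u (m + p)).trans (mul_le_mul_of_nonneg_left ?_ hC')
      exact add_le_add (windowMass_shift_le hh.le (by omega) _ _)
        (windowMass_shift_le hh.le (by omega) _ _)
    have h5 : ↑(R * n) * h * (C' * (U + V)) ≤ 2 * R * (C' * (U + V)) := by
      refine mul_le_mul_of_nonneg_right ?_ (by positivity)
      push_cast
      nlinarith [(Nat.cast_nonneg R : (0 : ℝ) ≤ R)]
    refine (ih h n hh hnh hnh2 u m).trans ?_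
    rw [mul_assoc]
    refine mul_le_mul_of_nonneg_left ?_ hC
    linarith

lemma jb_pos (x : ℝ) : 0 < jb x := Real.sqrt_pos.2 (by positivity)

lemma jb_le_mul_jb_add (x : ℝ) {d : ℝ} (hd : 0 ≤ d) : jb x ≤ (1 + d) * jb (x + d) := by
  unfold jb
  refine Real.sqrt_le_iff.2 ⟨by positivity, ?_⟩
  rw [mul_pow, Real.sq_sqrt (by positivity)]
  have h1 : 0 ≤ d * (x + d + 1) ^ 2 := by positivity
  have h2 : 0 ≤ d ^ 2 * (x + d) ^ 2 := by positivity
  have h3 : 0 ≤ d * (x + d) ^ 2 := by positivity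
  nlinarith

lemma jb_pow_mul_windowMass_le {h : ℝ} (hh : 0 ≤ h) {M : ℕ} {L : ℝ} (hM : M * h ≤ L) (N : ℕ)
    (f : ℤ → ℝ) (m : ℤ) :
    jb (m * h) ^ N * windowMass h M f m ≤ (1 + L) ^ N * windowMass h M (wt h N f) m := by
  unfold windowMass
  rw [mul_left_comm, mul_left_comm ((1 + L) ^ N)]
  refine mul_le_mul_of_nonneg_left ?_ hh
  rw [Finset.mul_sum, Finset.mul_sum]
  refine Finset.sum_le_sum fun p hp => ?_
  have hp' : (p : ℝ) ≤ M := by exact_mod_cast (Finset.mem_range.1 hp).le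
  have hpL : p * h ≤ L := (mul_le_mul_of_nonneg_right hp' hh).trans hM
  have hp0 : 0 ≤ p * h := by positivity
  have h1 : jb (m * h) ≤ (1 + L) * jb (((m + p : ℤ) : ℝ) * h) := by
    refine (jb_le_mul_jb_add _ hp0).trans ?_
    rw [show ((m + p : ℤ) : ℝ) * h = m * h + p * h by push_cast; ring]
    exact mul_le_mul_of_nonneg_right (by linarith) (jb_pos _).le
  rw [wt, abs_mul, abs_of_pos (pow_pos (jb_pos _) N), ← mul_assoc, ← mul_pow]
  exact mul_le_mul_of_nonneg_right (pow_le_pow_left₀ (jb_pos _).le h1 N) (abs_nonneg _)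

lemma windowMass_le_dnorm {h : ℝ} (hh : 0 ≤ h) {M : ℕ} {L : ℝ} (hM : M * h ≤ L) {g : ℤ → ℝ}
    (hg : Summable fun m : ℤ => g m ^ 2 * h) (m : ℤ) :
    windowMass h M g m ≤ (1 + L) * dnorm h g := by
  have hL : 0 ≤ L := le_trans (by positivity) hM
  have hD : 0 ≤ dnorm h g := Real.sqrt_nonneg _
  have hsum : ∑ p ∈ Finset.range M, g (m + p) ^ 2 * h ≤ dnorm h g ^ 2 := by
    rw [dnorm, Real.sq_sqrt (tsum_nonneg fun _ => by positivity)]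
    rw [← Finset.sum_image (s := Finset.range M) (g := fun p : ℕ => m + (p : ℤ))
      (f := fun q => g q ^ 2 * h) (by intro a _ b _ hab; simpa using hab)]
    exact hg.sum_le_tsum _ fun _ _ => by positivity
  refine abs_le_of_sq_le_sq' ?_ (by positivity) |>.2
  have hcs : (∑ p ∈ Finset.range M, |g (m + p)|) ^ 2
      ≤ M * ∑ p ∈ Finset.range M, g (m + p) ^ 2 := by
    simpa using sq_sum_le_card_mul_sum_sq (s := Finset.range M) (f := fun p : ℕ => |g (m + p)|)
  rw [← Finset.sum_mul] at hsum
  calc windowMass h M g m ^ 2 = h ^ 2 * (∑ p ∈ Finset.range M, |g (m + p)|) ^ 2 := mul_pow _ _ _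
    _ ≤ h ^ 2 * (M * ∑ p ∈ Finset.range M, g (m + p) ^ 2) := by gcongr
    _ = M * h * ((∑ p ∈ Finset.range M, g (m + p) ^ 2) * h) := by ring
    _ ≤ L * dnorm h g ^ 2 := by gcongr
    _ ≤ ((1 + L) * dnorm h g) ^ 2 := by
      rw [mul_pow]
      gcongr
      nlinarith

/-- weighted discrete Sobolev inequality
`sup_x |⟨x⟩^N D₊^j u(x)| ≤ C (‖⟨x⟩^N u‖_{L²_h} + ‖⟨x⟩^N D₊^{j+l} u‖_{L²_h})` for `l ≥ 1`,
with `C` independent of `h ∈ (0,1)` and `u`, whenever the right-hand side is finite. -/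
theorem statement7 (N j l : ℕ) (hl : 1 ≤ l) :
    ∃ C > (0 : ℝ), ∀ h ∈ Set.Ioo (0 : ℝ) 1, ∀ u : ℤ → ℝ,
      Summable (fun m : ℤ => wt h N u m ^ 2 * h) →
      Summable (fun m : ℤ => wt h N ((Dp h)^[j + l] u) m ^ 2 * h) →
      ∀ m : ℤ, |wt h N ((Dp h)^[j] u) m|
        ≤ C * (dnorm h (wt h N u) + dnorm h (wt h N ((Dp h)^[j + l] u))) := by
  obtain ⟨l, rfl⟩ := Nat.exists_eq_add_of_le' hl
  obtain ⟨C, hC, R, hloc⟩ := exists_abs_Dp_iterate_le_add j l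
  refine ⟨C * ((1 + 2 * R) ^ N * (1 + 2 * R)) + 1, by positivity, ?_⟩
  rintro h ⟨hh, hh1⟩ u hu hDu m
  set n := ⌈1 / h⌉₊
  have hnh : 1 ≤ n * h := (div_le_iff₀ hh).1 (Nat.le_ceil _)
  have hnh2 : n * h ≤ 2 := by
    have h1 := mul_lt_mul_of_pos_right (Nat.ceil_lt_add_one (by positivity : 0 ≤ 1 / h)) hh
    rw [add_mul, div_mul_cancel₀ _ hh.ne'] at h1
    linarith
  have hM : ((R * n : ℕ) : ℝ) * h ≤ 2 * R := by
    push_cast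
    nlinarith [(Nat.cast_nonneg R : (0 : ℝ) ≤ R)]
  have hbound : ∀ f : ℤ → ℝ, Summable (fun m : ℤ => wt h N f m ^ 2 * h) →
      jb (m * h) ^ N * windowMass h (R * n) f m
        ≤ (1 + 2 * R) ^ N * (1 + 2 * R) * dnorm h (wt h N f) := fun f hf => by
    rw [mul_assoc]
    exact (jb_pow_mul_windowMass_le hh.le hM N f m).trans
      (mul_le_mul_of_nonneg_left (windowMass_le_dnorm hh.le hM hf m) (by positivity))
  have hj : 0 < jb (m * h) ^ N := pow_pos (jb_pos _) N
  have h1 := mul_le_mul_of_nonneg_left (hloc h n hh hnh hnh2 u m) hj.le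
  have h2 := mul_le_mul_of_nonneg_left (add_le_add (hbound _ hu) (hbound _ hDu)) hC
  have h3 : 0 ≤ dnorm h (wt h N u) := Real.sqrt_nonneg _
  have h4 : 0 ≤ dnorm h (wt h N ((Dp h)^[j + (l + 1)] u)) := Real.sqrt_nonneg _
  rw [wt, abs_mul, abs_of_pos hj]
  linarith
end
end

section
/- Suppose P, Q : ℝ → ℝ are C¹, nondecreasing, positive functions, let T₀ > 0 and K > 0. Then there exist T with 0 < T ≤ T₀ and L, ε > 0, depending only on K, P, and Q, with the following property: for every Δt with 0 < Δt < ε and every function η : [0, T₀] → ℝ such that, writing t_j = jΔt and η_j = η(t_j), one has (η_{j+1} − η_j)/Δt ≤ P(η_j)·η_{j+1} + Q(η_j) for each j with t_j, t_{j+1} ∈ [0, T₀], and such that η₀ ≤ K, it follows that η_j ≤ L for each j with t_j ≤ T. Moreover, if P and Q are constant functions then one may take T = T₀. -/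
noncomputable section

/-- `1 / (1 - x)` is dominated by `exp (2 * x)` for `0 ≤ x ≤ 1 / 2`. -/
theorem one_le_one_sub_mul_exp_two_mul {x : ℝ} (hx₀ : 0 ≤ x) (hx : x ≤ 1 / 2) :
    1 ≤ (1 - x) * Real.exp (2 * x) := by
  have h := Real.add_one_le_exp (2 * x)
  nlinarith [mul_le_mul_of_nonneg_left h (by linarith : 0 ≤ 1 - x)]

/-- Implicit discrete Gronwall inequality: as long as the exponential bound stays below `L`, where
the coefficients `P` and `Q` are bounded by `p` and `c * p`, it bounds the sequence. -/
theorem add_le_mul_exp_of_discrete_ineq {P Q : ℝ → ℝ} {T₀ T K L p c Δt : ℝ} {η : ℝ → ℝ}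
    (hT : T ≤ T₀) (hK : 0 < K) (hp : 0 < p) (hc : 0 ≤ c)
    (hPL : ∀ x ≤ L, P x ≤ p) (hQL : ∀ x ≤ L, Q x ≤ c * p)
    (hL : (K + c) * Real.exp (2 * (p * T)) - c ≤ L)
    (hΔ : 0 < Δt) (hΔp : p * Δt ≤ 1 / 2) (h₀ : η 0 ≤ K)
    (hη : ∀ j : ℕ, ((j : ℝ) + 1) * Δt ≤ T₀ →
      (η (((j : ℝ) + 1) * Δt) - η ((j : ℝ) * Δt)) / Δt
        ≤ P (η ((j : ℝ) * Δt)) * η (((j : ℝ) + 1) * Δt) + Q (η ((j : ℝ) * Δt)))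
    (j : ℕ) (hj : (j : ℝ) * Δt ≤ T) :
    η ((j : ℝ) * Δt) + c ≤ (K + c) * Real.exp (2 * (p * ((j : ℝ) * Δt))) := by
  induction j with
  | zero => simpa using h₀
  | succ j ih =>
    push_cast at hj ⊢
    have hjT : (j : ℝ) * Δt ≤ T := by linarith
    have hx := ih hjT
    have hxL : η ((j : ℝ) * Δt) ≤ L := by
      have : (K + c) * Real.exp (2 * (p * ((j : ℝ) * Δt))) ≤ (K + c) * Real.exp (2 * (p * T)) := by
        gcongr
      linarith
    have hstep := hη j (hj.trans hT)
    rw [div_le_iff₀ hΔ] at hstep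
    have hPx := hPL _ hxL
    have hQx := hQL _ hxL
    generalize η (((j : ℝ) + 1) * Δt) = y at *
    generalize η ((j : ℝ) * Δt) = x at *
    have hKc : 0 < K + c := by linarith
    rcases le_or_gt y 0 with hy | hy
    · have : 1 ≤ Real.exp (2 * (p * (((j : ℝ) + 1) * Δt))) := Real.one_le_exp (by positivity)
      nlinarith
    · have hcoef : (P x * y + Q x) * Δt ≤ (p * y + c * p) * Δt := by gcongr
      have hmul : (1 - p * Δt) * (y + c) ≤ x + c := by linarith
      have hexp := one_le_one_sub_mul_exp_two_mul (by positivity : 0 ≤ p * Δt) hΔp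
      have hsplit : Real.exp (2 * (p * (((j : ℝ) + 1) * Δt)))
          = Real.exp (2 * (p * ((j : ℝ) * Δt))) * Real.exp (2 * (p * Δt)) := by
        rw [← Real.exp_add]; ring_nf
      calc y + c ≤ (1 - p * Δt) * Real.exp (2 * (p * Δt)) * (y + c) :=
            le_mul_of_one_le_left (by linarith) hexp
        _ = (1 - p * Δt) * (y + c) * Real.exp (2 * (p * Δt)) := by ring
        _ ≤ (K + c) * Real.exp (2 * (p * ((j : ℝ) * Δt))) * Real.exp (2 * (p * Δt)) := by
            exact mul_le_mul_of_nonneg_right (hmul.trans hx) (Real.exp_pos _).le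
        _ = _ := by rw [hsplit]; ring

/-- `L`-bound form of `add_le_mul_exp_of_discrete_ineq`, with an explicit step-size threshold. -/
theorem le_of_discrete_ineq {P Q : ℝ → ℝ} {T₀ T K L p c : ℝ}
    (hT : T ≤ T₀) (hK : 0 < K) (hp : 0 < p) (hc : 0 ≤ c)
    (hPL : ∀ x ≤ L, P x ≤ p) (hQL : ∀ x ≤ L, Q x ≤ c * p)
    (hL : (K + c) * Real.exp (2 * (p * T)) - c ≤ L)
    (Δt : ℝ) (hΔ : 0 < Δt) (hΔε : Δt < 1 / (2 * p)) (η : ℝ → ℝ) (h₀ : η 0 ≤ K)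
    (hη : ∀ j : ℕ, ((j : ℝ) + 1) * Δt ≤ T₀ →
      (η (((j : ℝ) + 1) * Δt) - η ((j : ℝ) * Δt)) / Δt
        ≤ P (η ((j : ℝ) * Δt)) * η (((j : ℝ) + 1) * Δt) + Q (η ((j : ℝ) * Δt)))
    (j : ℕ) (hj : (j : ℝ) * Δt ≤ T) :
    η ((j : ℝ) * Δt) ≤ L := by
  have hΔp : p * Δt ≤ 1 / 2 := by
    rw [lt_div_iff₀ (by positivity)] at hΔε
    linarith
  have h := add_le_mul_exp_of_discrete_ineq hT hK hp hc hPL hQL hL hΔ hΔp h₀ hη j hj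
  have : (K + c) * Real.exp (2 * (p * ((j : ℝ) * Δt))) ≤ (K + c) * Real.exp (2 * (p * T)) := by
    gcongr
  linarith

/-- discrete Gronwall-type lemma.  If `P, Q` are `C¹`, nondecreasing, positive
functions, `T₀ > 0` and `K > 0`, then there are `0 < T ≤ T₀` and `L, ε > 0` (independent of
`Δt` and `η`) such that any `η` satisfying the discrete differential inequality
`(η_{j+1} − η_j)/Δt ≤ P(η_j) η_{j+1} + Q(η_j)` with `η₀ ≤ K` and `0 < Δt < ε` satisfies
`η_j ≤ L` for all `j` with `t_j ≤ T`; moreover, if `P` and `Q` are constant one may take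
`T = T₀`. -/
theorem statement8 (P Q : ℝ → ℝ)
    (hP : ContDiff ℝ 1 P) (hQ : ContDiff ℝ 1 Q)
    (hPmono : Monotone P) (hQmono : Monotone Q)
    (hPpos : ∀ x : ℝ, 0 < P x) (hQpos : ∀ x : ℝ, 0 < Q x)
    (T₀ : ℝ) (hT₀ : 0 < T₀) (K : ℝ) (hK : 0 < K) :
    (∃ T L ε : ℝ, 0 < T ∧ T ≤ T₀ ∧ 0 < L ∧ 0 < ε ∧
      ∀ Δt : ℝ, 0 < Δt → Δt < ε → ∀ η : ℝ → ℝ, η 0 ≤ K →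
        (∀ j : ℕ, ((j : ℝ) + 1) * Δt ≤ T₀ →
          (η (((j : ℝ) + 1) * Δt) - η ((j : ℝ) * Δt)) / Δt
            ≤ P (η ((j : ℝ) * Δt)) * η (((j : ℝ) + 1) * Δt) + Q (η ((j : ℝ) * Δt))) →
        ∀ j : ℕ, (j : ℝ) * Δt ≤ T → η ((j : ℝ) * Δt) ≤ L) ∧
    ((∀ x y : ℝ, P x = P y) → (∀ x y : ℝ, Q x = Q y) →
      ∃ L ε : ℝ, 0 < L ∧ 0 < ε ∧
      ∀ Δt : ℝ, 0 < Δt → Δt < ε → ∀ η : ℝ → ℝ, η 0 ≤ K →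
        (∀ j : ℕ, ((j : ℝ) + 1) * Δt ≤ T₀ →
          (η (((j : ℝ) + 1) * Δt) - η ((j : ℝ) * Δt)) / Δt
            ≤ P (η ((j : ℝ) * Δt)) * η (((j : ℝ) + 1) * Δt) + Q (η ((j : ℝ) * Δt))) →
        ∀ j : ℕ, (j : ℝ) * Δt ≤ T₀ → η ((j : ℝ) * Δt) ≤ L) := by
  refine ⟨?_, fun hPc hQc => ?_⟩
  · have hp := hPpos (K + 1)
    have hq := hQpos (K + 1)
    set p := P (K + 1) with hp_def
    set c := Q (K + 1) / p with hc_def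
    have hc : 0 < c := by positivity
    have hcp : c * p = Q (K + 1) := div_mul_cancel₀ _ hp.ne'
    have hlog : 0 < Real.log (1 + 1 / (K + c)) :=
      Real.log_pos (lt_add_of_pos_right _ (by positivity))
    refine ⟨min T₀ (Real.log (1 + 1 / (K + c)) / (2 * p)), K + 1, 1 / (2 * p),
      lt_min hT₀ (by positivity), min_le_left _ _, by positivity, by positivity, ?_⟩
    refine le_of_discrete_ineq (min_le_left _ _) hK hp hc.le (fun x hx => hPmono hx)
      (fun x hx => hcp ▸ hQmono hx) ?_
    have hT : 2 * (p * min T₀ (Real.log (1 + 1 / (K + c)) / (2 * p)))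
        ≤ Real.log (1 + 1 / (K + c)) := by
      have h := min_le_right T₀ (Real.log (1 + 1 / (K + c)) / (2 * p))
      rw [le_div_iff₀ (by positivity)] at h
      linarith
    have hexp := Real.exp_le_exp.mpr hT
    rw [Real.exp_log (by positivity)] at hexp
    have h := mul_le_mul_of_nonneg_left hexp (by positivity : 0 ≤ K + c)
    have h1 : (K + c) * (1 + 1 / (K + c)) = K + c + 1 := by field_simp
    linarith
  · have hp := hPpos 0
    have hc : 0 < Q 0 / P 0 := div_pos (hQpos 0) hp
    exact ⟨(K + Q 0 / P 0) * Real.exp (2 * (P 0 * T₀)), 1 / (2 * P 0), by positivity,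
      by positivity, le_of_discrete_ineq le_rfl hK hp hc.le (fun x _ => (hPc x 0).le)
        (fun x _ => (div_mul_cancel₀ (Q 0) hp.ne').symm ▸ (hQc x 0).le) (by linarith)⟩
end
end

section
/- Let μ ∈ {1, −1}, T > 0, and let f₁, f₂ : ℝ×[0,∞) → ℝ be smooth functions such that for every n ∈ ℕ there is C > 0 with |∂_x^n f_l(x,t)| ≤ C⟨x⟩^(−n) for all x ∈ ℝ, t ∈ [0,T], l = 1,2. Then there exists C > 0, depending only on f₁, f₂ and T (not on h, k, j, or the mesh functions u_j), such that: for all h, k ∈ (0,1), for every j with t_j = jk ∈ [0,T], for every ℝ²-valued mesh function u_j = ((u₁)_j, (u₂)_j) on ℝ_h with ‖u_j‖_{S_h} < ∞, and for every ℝ²-valued mesh function u = (u₁, u₂) with ‖u‖_{S_h} < ∞, one has (Q_j u, u)_{S_h} ≥ −C ‖u‖_{S_h}² (1 + ‖u_j‖_{S_h}²), where Q_j is the operator built from u_j, f₁, f₂ as in the context. -/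
noncomputable section

/-- Backward difference operator with mesh size `h`. -/
def Dm (h : ℝ) (u : ℤ → ℝ) : ℤ → ℝ := fun m => (u m - u (m - 1)) / h

/-- The discrete `L²_h` inner product `(u,v)_{L²_h} = Σ_m u(x_m) v(x_m) h`. -/
def dip (h : ℝ) (u v : ℤ → ℝ) : ℝ := ∑' m : ℤ, u m * v m * h

/-- The `S_h` inner product of real-valued mesh functions. -/
def ship (h : ℝ) (u v : ℤ → ℝ) : ℝ :=
  dip h (fun m => jb ((m : ℝ) * h) * u m) (fun m => jb ((m : ℝ) * h) * v m) +
    dip h (fun m => jb ((m : ℝ) * h) * Dp h u m) (fun m => jb ((m : ℝ) * h) * Dp h v m) +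
    dip h ((Dp h)^[2] u) ((Dp h)^[2] v)

/-- The squared `S_h` norm of an `ℝ²`-valued mesh function `(u₁, u₂)`. -/
def shnormSq (h : ℝ) (u1 u2 : ℤ → ℝ) : ℝ := ship h u1 u1 + ship h u2 u2

/-- Finiteness of the `S_h` norm of a real-valued mesh function. -/
def InSh (h : ℝ) (u : ℤ → ℝ) : Prop :=
  Summable (fun m : ℤ => (jb ((m : ℝ) * h) * u m) ^ 2 * h) ∧
    Summable (fun m : ℤ => (jb ((m : ℝ) * h) * Dp h u m) ^ 2 * h) ∧
    Summable (fun m : ℤ => ((Dp h)^[2] u m) ^ 2 * h)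

/-- First component of the operator `Q_j` built from the mesh functions `u1, u2`
(the discrete solution at time `t_j`) and `f1, f2` (the background at time `t_j`). -/
def Q1 (μ h : ℝ) (u1 u2 f1 f2 ρ1 ρ2 : ℤ → ℝ) : ℤ → ℝ := fun m =>
  Dp h (Dm h ρ2) m + μ * u1 m * u2 m * ρ1 m + μ * u2 m ^ 2 * ρ2 m
    + 2 * μ * u2 m * f1 m * ρ1 m + μ * u1 m * f2 m * ρ1 m + 3 * μ * u2 m * f2 m * ρ2 m

/-- Second component of the operator `Q_j`. -/
def Q2 (μ h : ℝ) (u1 u2 f1 f2 ρ1 ρ2 : ℤ → ℝ) : ℤ → ℝ := fun m =>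
  -(Dp h (Dm h ρ1) m) - μ * u1 m ^ 2 * ρ1 m - μ * u1 m * u2 m * ρ2 m
    - 3 * μ * f1 m * u1 m * ρ1 m - μ * f1 m * u2 m * ρ2 m - 2 * μ * f2 m * u1 m * ρ2 m

lemma jb_sq (x : ℝ) : jb x ^ 2 = x ^ 2 + 1 := Real.sq_sqrt (by positivity)

lemma one_le_jb (x : ℝ) : 1 ≤ jb x := Real.one_le_sqrt.2 (by nlinarith [sq_nonneg x])

lemma Summable.mul_of_sq {ι : Type*} {f g : ι → ℝ} (hf : Summable fun i => f i ^ 2)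
    (hg : Summable fun i => g i ^ 2) : Summable fun i => f i * g i := by
  refine Summable.of_norm_bounded (hf.add hg) fun i => ?_
  rw [Real.norm_eq_abs, abs_le]
  constructor <;> nlinarith [sq_nonneg (f i + g i), sq_nonneg (f i - g i)]

/-- Mesh functions that are square summable against the weight `⟨x⟩²`. -/
def WeightedL2 (h : ℝ) (u : ℤ → ℝ) : Prop := Summable fun m : ℤ => (jb ((m : ℝ) * h) * u m) ^ 2

namespace WeightedL2

variable {h : ℝ} {u v : ℤ → ℝ}

lemma of_le {g : ℤ → ℝ} (hg : Summable g) (hle : ∀ m : ℤ, (jb ((m : ℝ) * h) * u m) ^ 2 ≤ g m) :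
    WeightedL2 h u :=
  Summable.of_nonneg_of_le (fun _ => sq_nonneg _) hle hg

lemma add (hu : WeightedL2 h u) (hv : WeightedL2 h v) : WeightedL2 h (u + v) := by
  refine of_le ((Summable.add hu hv).mul_left 2) fun m => ?_
  simp only [Pi.add_apply]
  nlinarith [sq_nonneg (jb ((m : ℝ) * h) * u m - jb ((m : ℝ) * h) * v m)]

lemma smul (c : ℝ) (hu : WeightedL2 h u) : WeightedL2 h (c • u) := by
  refine of_le (Summable.mul_left (c ^ 2) hu) fun m => le_of_eq ?_
  simp only [Pi.smul_apply, smul_eq_mul]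
  ring

lemma bdd_mul {A : ℝ} (hA : ∀ m, u m ^ 2 ≤ A) (hv : WeightedL2 h v) : WeightedL2 h (u * v) := by
  refine of_le (Summable.mul_left A hv) fun m => ?_
  simp only [Pi.mul_apply]
  calc (jb (m * h) * (u m * v m)) ^ 2 = u m ^ 2 * (jb (m * h) * v m) ^ 2 := by ring
    _ ≤ _ := mul_le_mul_of_nonneg_right (hA m) (sq_nonneg _)

lemma shift (c : ℤ) (hc : ((c : ℝ) * h) ^ 2 ≤ 1) (hu : WeightedL2 h u) :
    WeightedL2 h fun m => u (m + c) := by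
  have h1 : Summable fun m : ℤ => (jb (((m + c : ℤ) : ℝ) * h) * u (m + c)) ^ 2 :=
    (Equiv.addRight c).summable_iff.2 hu
  refine of_le (h1.mul_left 3) fun m => ?_
  rw [mul_pow, mul_pow, jb_sq, jb_sq, ← mul_assoc]
  refine mul_le_mul_of_nonneg_right ?_ (sq_nonneg _)
  push_cast
  nlinarith [sq_nonneg ((m : ℝ) * h + 2 * (c * h))]

lemma forward_diff (h0 : 0 < h) (h1 : h < 1) (hu : WeightedL2 h u) : WeightedL2 h (Dp h u) := by
  have e : Dp h u = h⁻¹ • ((fun m => u (m + 1)) + (-1 : ℝ) • u) := by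
    funext m
    simp [Dp]
    ring
  rw [e]
  exact ((hu.shift 1 (by push_cast; nlinarith)).add (hu.smul _)).smul _

lemma backward_diff (h0 : 0 < h) (h1 : h < 1) (hu : WeightedL2 h u) : WeightedL2 h (Dm h u) := by
  have e : Dm h u = h⁻¹ • (u + (-1 : ℝ) • (fun m => u (m + -1))) := by
    funext m
    simp [Dm, sub_eq_add_neg]
    ring
  rw [e]
  exact (hu.add ((hu.shift (-1) (by push_cast; nlinarith)).smul _)).smul _

lemma summable_sq (hu : WeightedL2 h u) : Summable fun m => u m ^ 2 := by
  refine Summable.of_nonneg_of_le (fun _ => sq_nonneg _) (fun m => ?_) hu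
  rw [mul_pow, jb_sq]
  nlinarith [mul_nonneg (sq_nonneg ((m : ℝ) * h)) (sq_nonneg (u m))]

/-- A product of two weighted square summable functions is summable against any `p` with
`|p| ≤ ⟨x⟩²`. -/
lemma summable_mul {p : ℤ → ℝ} (hp : ∀ m : ℤ, |p m| ≤ jb ((m : ℝ) * h) ^ 2)
    (hu : WeightedL2 h u) (hv : WeightedL2 h v) : Summable fun m => p m * (u m * v m) := by
  refine Summable.of_norm_bounded (Summable.mul_of_sq hu hv).abs fun m => ?_
  rw [Real.norm_eq_abs, abs_mul]
  calc |p m| * |u m * v m| ≤ jb (m * h) ^ 2 * |u m * v m| :=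
        mul_le_mul_of_nonneg_right (hp m) (abs_nonneg _)
    _ = |jb (m * h) * u m * (jb (m * h) * v m)| := by
        rw [← abs_of_nonneg (sq_nonneg (jb (m * h))), ← abs_mul]
        ring_nf

end WeightedL2

lemma InSh.weightedL2 {h : ℝ} {u : ℤ → ℝ} (h0 : 0 < h) (hu : InSh h u) : WeightedL2 h u :=
  (summable_mul_right_iff h0.ne').1 hu.1

/-- The summand of the `S_h` inner product. -/
def shDensity (h : ℝ) (u v : ℤ → ℝ) (m : ℤ) : ℝ :=
  (jb ((m : ℝ) * h) ^ 2 * (u m * v m) + jb ((m : ℝ) * h) ^ 2 * (Dp h u m * Dp h v m)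
    + Dp h (Dp h u) m * Dp h (Dp h v) m) * h

section InnerProduct

variable {h : ℝ} {u v : ℤ → ℝ}

lemma hasSum_shDensity (h0 : 0 < h) (h1 : h < 1) (hu : WeightedL2 h u) (hv : WeightedL2 h v) :
    HasSum (shDensity h u v) (ship h u v) := by
  have hp : ∀ m : ℤ, |jb ((m : ℝ) * h) ^ 2| ≤ jb ((m : ℝ) * h) ^ 2 := fun m =>
    (abs_of_nonneg (sq_nonneg _)).le
  have hdu := hu.forward_diff h0 h1
  have hdv := hv.forward_diff h0 h1
  have s1 := (WeightedL2.summable_mul hp hu hv).mul_right h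
  have s2 := (WeightedL2.summable_mul hp hdu hdv).mul_right h
  have s3 := (Summable.mul_of_sq (hdu.forward_diff h0 h1).summable_sq
    (hdv.forward_diff h0 h1).summable_sq).mul_right h
  have e : ship h u v = ∑' m : ℤ, jb ((m : ℝ) * h) ^ 2 * (u m * v m) * h
      + ∑' m : ℤ, jb ((m : ℝ) * h) ^ 2 * (Dp h u m * Dp h v m) * h
      + ∑' m : ℤ, Dp h (Dp h u) m * Dp h (Dp h v) m * h := by
    simp only [ship, dip, Function.iterate_succ, Function.iterate_zero, Function.comp, id]
    congr 1
    congr 1 <;> exact tsum_congr fun m => by ring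
  rw [e]
  refine HasSum.congr_fun ((s1.hasSum.add s2.hasSum).add s3.hasSum) fun m => ?_
  simp only [shDensity]
  ring

lemma shDensity_self_nonneg (h0 : 0 < h) (u : ℤ → ℝ) (m : ℤ) : 0 ≤ shDensity h u u m := by
  unfold shDensity
  have := mul_self_nonneg (u m)
  have := mul_self_nonneg (Dp h u m)
  have := mul_self_nonneg (Dp h (Dp h u) m)
  positivity

lemma ship_self_nonneg (h0 : 0 < h) (h1 : h < 1) (hu : WeightedL2 h u) : 0 ≤ ship h u u :=
  (hasSum_shDensity h0 h1 hu hu).nonneg (shDensity_self_nonneg h0 u)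

lemma ship_add_left (h0 : 0 < h) (h1 : h < 1) {w : ℤ → ℝ} (hu : WeightedL2 h u)
    (hv : WeightedL2 h v) (hw : WeightedL2 h w) :
    ship h (u + v) w = ship h u w + ship h v w := by
  refine (hasSum_shDensity h0 h1 (hu.add hv) hw).unique ?_
  refine HasSum.congr_fun
    ((hasSum_shDensity h0 h1 hu hw).add (hasSum_shDensity h0 h1 hv hw)) fun m => ?_
  simp only [shDensity, Dp, Pi.add_apply]
  ring

lemma ship_smul_left (h0 : 0 < h) (h1 : h < 1) (c : ℝ) (hu : WeightedL2 h u)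
    (hv : WeightedL2 h v) : ship h (c • u) v = c * ship h u v := by
  refine (hasSum_shDensity h0 h1 (hu.smul c) hv).unique ?_
  refine HasSum.congr_fun ((hasSum_shDensity h0 h1 hu hv).mul_left c) fun m => ?_
  simp only [shDensity, Dp, Pi.smul_apply, smul_eq_mul]
  ring

lemma abs_ship_le (h0 : 0 < h) (h1 : h < 1) {K S : ℝ} (hK : 0 < K) (hu : WeightedL2 h u)
    (hv : WeightedL2 h v) (huS : ship h u u ≤ K ^ 2 * S) (hvS : ship h v v ≤ S) :
    |ship h u v| ≤ K * S := by
  have hq : ∀ c : ℝ, 0 ≤ ship h u u + 2 * c * ship h u v + c ^ 2 * ship h v v := by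
    intro c
    refine HasSum.nonneg (fun m => ?_) (((hasSum_shDensity h0 h1 hu hu).add
      ((hasSum_shDensity h0 h1 hu hv).mul_left (2 * c))).add
      ((hasSum_shDensity h0 h1 hv hv).mul_left (c ^ 2)))
    have e : shDensity h u u m + 2 * c * shDensity h u v m + c ^ 2 * shDensity h v v m
        = (jb ((m : ℝ) * h) ^ 2 * (u m + c * v m) ^ 2
          + jb ((m : ℝ) * h) ^ 2 * (Dp h u m + c * Dp h v m) ^ 2
          + (Dp h (Dp h u) m + c * Dp h (Dp h v) m) ^ 2) * h := by
      unfold shDensity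
      ring
    rw [e]
    positivity
  have b := mul_le_mul_of_nonneg_left hvS (sq_nonneg K)
  have p := hq K
  have n := hq (-K)
  rw [abs_le]
  constructor <;> refine le_of_mul_le_mul_left ?_ (show (0 : ℝ) < 2 * K by positivity) <;> nlinarith

end InnerProduct

/-- Discrete Sobolev inequality in one dimension. -/
lemma sq_le_tsum_sq_add_sq_diff {h : ℝ} (h0 : 0 < h) {g : ℤ → ℝ}
    (hg : Summable fun m => g m ^ 2) (hdg : Summable fun m => Dp h g m ^ 2) (m : ℤ) :
    g m ^ 2 ≤ ∑' k, (g k ^ 2 + Dp h g k ^ 2) * h := by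
  have hg' : Summable fun k : ℤ => g (k + 1) ^ 2 := (Equiv.addRight (1 : ℤ)).summable_iff.2 hg
  let c : ℤ → ℝ := fun k => ((g k ^ 2 + g (k + 1) ^ 2) * 2⁻¹ + Dp h g k ^ 2) * h
  have hc : Summable c := (((hg.add hg').mul_right 2⁻¹).add hdg).mul_right h
  have hc0 : ∀ k, 0 ≤ c k := fun k => by positivity
  have hstep : ∀ k, g k ^ 2 ≤ g (k + 1) ^ 2 + c k := by
    intro k
    have e : g (k + 1) = g k + h * Dp h g k := by
      simp only [Dp]
      field_simp
      ring
    have : c k - (g k ^ 2 - g (k + 1) ^ 2) =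
        h * ((g k + g (k + 1) + 2 * Dp h g k) ^ 2 + (g k - g (k + 1)) ^ 2) / 4 := by
      simp only [c]
      rw [e]
      ring
    nlinarith [show 0 ≤ h * ((g k + g (k + 1) + 2 * Dp h g k) ^ 2 + (g k - g (k + 1)) ^ 2) / 4
      by positivity]
  have hfin : ∀ n : ℕ, g m ^ 2 ≤ g (m + n) ^ 2 + ∑ i ∈ Finset.range n, c (m + i) := by
    intro n
    induction n with
    | zero => simp
    | succ n ih =>
      rw [Finset.sum_range_succ]
      have := hstep (m + n)
      push_cast
      rw [← add_assoc m]
      linarith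
  have hinj : Function.Injective fun n : ℕ => m + (n : ℤ) := fun a b hab => by simpa using hab
  have hle : ∀ n : ℕ, g m ^ 2 ≤ g (m + n) ^ 2 + ∑' k, c k := by
    intro n
    have h1 := (hc.comp_injective hinj).sum_le_tsum (Finset.range n) fun i _ => hc0 _
    have h2 := tsum_comp_le_tsum_of_inj hc hc0 hinj
    have := hfin n
    simp only [Function.comp_def] at h1 h2
    linarith
  have hlim : Filter.Tendsto (fun n : ℕ => g (m + n) ^ 2 + ∑' k, c k) Filter.atTop
      (nhds (0 + ∑' k, c k)) :=
    ((hg.comp_injective hinj).tendsto_atTop_zero).add_const _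
  have hfinal := ge_of_tendsto' hlim hle
  have hshift : ∑' k : ℤ, g (k + 1) ^ 2 = ∑' k, g k ^ 2 :=
    (Equiv.addRight (1 : ℤ)).tsum_eq fun k => g k ^ 2
  have hcsum : ∑' k, c k = ∑' k, (g k ^ 2 + Dp h g k ^ 2) * h := by
    simp only [c]
    rw [tsum_mul_right, tsum_mul_right, ((hg.add hg').mul_right 2⁻¹).tsum_add hdg, tsum_mul_right,
      hg.tsum_add hg', hshift, hg.tsum_add hdg]
    ring
  rw [← hcsum]
  simpa using hfinal

section Multiplication

variable {h : ℝ} {u v : ℤ → ℝ}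

lemma sq_le_ship_self (h0 : 0 < h) (h1 : h < 1) (hu : WeightedL2 h u) (m : ℤ) :
    u m ^ 2 ≤ ship h u u := by
  have hd := hu.forward_diff h0 h1
  refine (sq_le_tsum_sq_add_sq_diff h0 hu.summable_sq hd.summable_sq m).trans ?_
  have hs := hasSum_shDensity h0 h1 hu hu
  rw [← hs.tsum_eq]
  refine ((hu.summable_sq.add hd.summable_sq).mul_right h).tsum_le_tsum (fun k => ?_) hs.summable
  refine mul_le_mul_of_nonneg_right ?_ h0.le
  rw [jb_sq]
  have : 0 ≤ ((k : ℝ) * h) ^ 2 * (u k ^ 2 + Dp h u k ^ 2) := by positivity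
  nlinarith [sq_nonneg (Dp h (Dp h u) k)]

lemma sq_diff_le_ship_self (h0 : 0 < h) (h1 : h < 1) (hu : WeightedL2 h u) (m : ℤ) :
    Dp h u m ^ 2 ≤ ship h u u := by
  have hd := hu.forward_diff h0 h1
  have hdd := hd.forward_diff h0 h1
  refine (sq_le_tsum_sq_add_sq_diff h0 hd.summable_sq hdd.summable_sq m).trans ?_
  have hs := hasSum_shDensity h0 h1 hu hu
  rw [← hs.tsum_eq]
  refine ((hd.summable_sq.add hdd.summable_sq).mul_right h).tsum_le_tsum (fun k => ?_) hs.summable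
  refine mul_le_mul_of_nonneg_right ?_ h0.le
  rw [jb_sq]
  have : 0 ≤ ((k : ℝ) * h) ^ 2 * (u k ^ 2 + Dp h u k ^ 2) := by positivity
  nlinarith [sq_nonneg (u k)]

lemma shDensity_mul_le (h0 : 0 < h) {A : ℝ} (hA : ∀ m, u m ^ 2 ≤ A)
    (hdA : ∀ m, Dp h u m ^ 2 ≤ A) (m : ℤ) :
    shDensity h (u * v) (u * v) m ≤
      17 * A * shDensity h v v m + 3 * (Dp h (Dp h u) m ^ 2 * v m ^ 2) * h := by
  have e1 : Dp h (u * v) m = u (m + 1) * Dp h v m + Dp h u m * v m := by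
    simp only [Dp, Pi.mul_apply]
    field_simp
    ring
  have e2 : Dp h (Dp h (u * v)) m = u (m + 1 + 1) * Dp h (Dp h v) m
      + 2 * (Dp h u (m + 1) * Dp h v m) + Dp h (Dp h u) m * v m := by
    simp only [Dp, Pi.mul_apply]
    field_simp
    ring
  have hjb : 1 ≤ jb ((m : ℝ) * h) ^ 2 := one_le_pow₀ (one_le_jb _)
  have hA0 : 0 ≤ A := (sq_nonneg _).trans (hA 0)
  unfold shDensity
  rw [e1, e2, Pi.mul_apply]
  generalize jb ((m : ℝ) * h) ^ 2 = W at *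
  have hW : 0 ≤ W := by linarith
  have b1 := mul_le_mul_of_nonneg_right (hA m) (show 0 ≤ W * v m ^ 2 by positivity)
  have b2 := mul_le_mul_of_nonneg_right (hA (m + 1)) (show 0 ≤ W * Dp h v m ^ 2 by positivity)
  have b3 := mul_le_mul_of_nonneg_right (hdA m) (show 0 ≤ W * v m ^ 2 by positivity)
  have b4 := mul_le_mul_of_nonneg_right (hA (m + 1 + 1)) (sq_nonneg (Dp h (Dp h v) m))
  have b5 := mul_le_mul_of_nonneg_right (hdA (m + 1)) (sq_nonneg (Dp h v m))
  have b6 := mul_le_mul_of_nonneg_left hjb (show 0 ≤ A * Dp h v m ^ 2 by positivity)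
  have b7 : 0 ≤ A * (W * v m ^ 2) := by positivity
  have b8 : 0 ≤ A * (W * Dp h v m ^ 2) := by positivity
  have b9 : 0 ≤ A * Dp h (Dp h v) m ^ 2 := by positivity
  have t1 := mul_nonneg hW (sq_nonneg (u (m + 1) * Dp h v m - Dp h u m * v m))
  set X := u (m + 1 + 1) * Dp h (Dp h v) m with hX
  set Y := Dp h u (m + 1) * Dp h v m with hY
  set Z := Dp h (Dp h u) m * v m with hZ
  have t2 : (X + 2 * Y + Z) * (X + 2 * Y + Z) ≤ 3 * (X ^ 2 + 4 * Y ^ 2 + Z ^ 2) := by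
    nlinarith [sq_nonneg (X - 2 * Y), sq_nonneg (X - Z), sq_nonneg (2 * Y - Z)]
  have hX2 : X ^ 2 = u (m + 1 + 1) ^ 2 * Dp h (Dp h v) m ^ 2 := by rw [hX]; ring
  have hY2 : Y ^ 2 = Dp h u (m + 1) ^ 2 * Dp h v m ^ 2 := by rw [hY]; ring
  have hZ2 : Z ^ 2 = Dp h (Dp h u) m ^ 2 * v m ^ 2 := by rw [hZ]; ring
  rw [hX2, hY2, hZ2] at t2
  rw [← mul_assoc (17 * A), ← add_mul]
  refine mul_le_mul_of_nonneg_right ?_ h0.le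
  nlinarith

/-- `S_h` is an algebra, with a constant that does not depend on `h`. -/
lemma ship_mul_self_le (h0 : 0 < h) (h1 : h < 1) (hu : WeightedL2 h u) (hv : WeightedL2 h v) :
    ship h (u * v) (u * v) ≤ 20 * (ship h u u * ship h v v) := by
  have su := hasSum_shDensity h0 h1 hu hu
  have sv := hasSum_shDensity h0 h1 hv hv
  have huv : WeightedL2 h (u * v) := hv.bdd_mul (sq_le_ship_self h0 h1 hu)
  refine (hasSum_le (fun m => ?_) (hasSum_shDensity h0 h1 huv huv)
    ((sv.mul_left (17 * ship h u u)).add (su.mul_left (3 * ship h v v)))).trans (le_of_eq (by ring))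
  refine (shDensity_mul_le h0 (sq_le_ship_self h0 h1 hu) (sq_diff_le_ship_self h0 h1 hu) m).trans ?_
  have b : Dp h (Dp h u) m ^ 2 * h ≤ shDensity h u u m := by
    refine mul_le_mul_of_nonneg_right ?_ h0.le
    have : 0 ≤ jb ((m : ℝ) * h) ^ 2 * (u m ^ 2 + Dp h u m ^ 2) := by positivity
    nlinarith
  have := mul_le_mul (sq_le_ship_self h0 h1 hv m) b (by positivity) (ship_self_nonneg h0 h1 hv)
  nlinarith

lemma ship_bdd_mul_self_le (h0 : 0 < h) (h1 : h < 1) {A : ℝ} (hA : ∀ m, u m ^ 2 ≤ A)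
    (hdA : ∀ m, Dp h u m ^ 2 ≤ A) (hddA : ∀ m, Dp h (Dp h u) m ^ 2 ≤ A) (hv : WeightedL2 h v) :
    ship h (u * v) (u * v) ≤ 20 * (A * ship h v v) := by
  have sv := hasSum_shDensity h0 h1 hv hv
  have huv : WeightedL2 h (u * v) := hv.bdd_mul hA
  rw [← mul_assoc]
  refine hasSum_le (fun m => ?_) (hasSum_shDensity h0 h1 huv huv) (sv.mul_left (20 * A))
  refine (shDensity_mul_le h0 hA hdA m).trans ?_
  have b : v m ^ 2 * h ≤ shDensity h v v m := by
    refine mul_le_mul_of_nonneg_right ?_ h0.le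
    have hjb : 1 ≤ jb ((m : ℝ) * h) ^ 2 := one_le_pow₀ (one_le_jb _)
    have : 0 ≤ jb ((m : ℝ) * h) ^ 2 * Dp h v m ^ 2 := by positivity
    nlinarith [mul_le_mul_of_nonneg_right hjb (sq_nonneg (v m)), sq_nonneg (Dp h (Dp h v) m)]
  have := mul_le_mul (hddA m) b (by positivity) ((sq_nonneg _).trans (hA 0))
  nlinarith

end Multiplication

/-- Summation by parts for the antisymmetric part of the discrete Laplacian. -/
lemma hasSum_laplacian_antisymm {h : ℝ} (h0 : 0 < h) (h1 : h < 1) {p a b : ℤ → ℝ}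
    (hp : ∀ m : ℤ, |p m| ≤ jb ((m : ℝ) * h) ^ 2) (ha : WeightedL2 h a) (hb : WeightedL2 h b) :
    ∃ s : ℝ, HasSum (fun m => p m * (Dp h (Dm h a) m * b m - Dp h (Dm h b) m * a m)) s ∧
      HasSum (fun m => -(Dp h p m * (Dp h a m * b m - Dp h b m * a m))) s := by
  let V : ℤ → ℝ := fun m => Dp h a m * b m - Dp h b m * a m
  have s1 : Summable fun m => p m * V m := by
    refine ((WeightedL2.summable_mul hp (ha.forward_diff h0 h1) hb).sub
      (WeightedL2.summable_mul hp (hb.forward_diff h0 h1) ha)).congr fun m => ?_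
    simp only [V]
    ring
  have s2 : Summable fun m => p m * V (m - 1) := by
    refine ((WeightedL2.summable_mul hp (ha.backward_diff h0 h1) hb).sub
      (WeightedL2.summable_mul hp (hb.backward_diff h0 h1) ha)).congr fun m => ?_
    simp only [V, Dp, Dm, sub_add_cancel]
    ring
  have s3 : HasSum (fun m => p (m + 1) * V m) (∑' m, p m * V (m - 1)) := by
    have := (Equiv.addRight (1 : ℤ)).hasSum_iff.2 s2.hasSum
    simpa [Function.comp_def] using this
  refine ⟨h⁻¹ * (∑' m, p m * V m - ∑' m, p m * V (m - 1)), ?_, ?_⟩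
  · refine HasSum.congr_fun ((s1.hasSum.sub s2.hasSum).mul_left h⁻¹) fun m => ?_
    simp only [V, Dp, Dm, sub_add_cancel, add_sub_cancel_right]
    field_simp
    ring
  · refine HasSum.congr_fun ((s1.hasSum.sub s3).mul_left h⁻¹) fun m => ?_
    simp only [V]
    rw [show Dp h p m = (p (m + 1) - p m) * h⁻¹ from div_eq_mul_inv _ _]
    ring

lemma laplacian_forward_diff_comm {h : ℝ} (u : ℤ → ℝ) :
    Dp h (Dp h (Dm h u)) = Dp h (Dm h (Dp h u)) := by
  funext m
  simp [Dp, Dm]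

lemma ship_laplacian_antisymm_ge {h : ℝ} (h0 : 0 < h) (h1 : h < 1) {v1 v2 : ℤ → ℝ}
    (hv1 : WeightedL2 h v1) (hv2 : WeightedL2 h v2) :
    -(3 * shnormSq h v1 v2) ≤
      ship h (Dp h (Dm h v2)) v1 - ship h (Dp h (Dm h v1)) v2 := by
  have hd1 := hv1.forward_diff h0 h1
  have hd2 := hv2.forward_diff h0 h1
  have hp : ∀ m : ℤ, |jb ((m : ℝ) * h) ^ 2| ≤ jb ((m : ℝ) * h) ^ 2 := fun m =>
    (abs_of_nonneg (sq_nonneg _)).le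
  have hone : ∀ m : ℤ, |(1 : ℝ)| ≤ jb ((m : ℝ) * h) ^ 2 := fun m => by
    rw [abs_one]
    exact one_le_pow₀ (one_le_jb _)
  obtain ⟨a, ha, ha'⟩ := hasSum_laplacian_antisymm h0 h1 hp hv2 hv1
  obtain ⟨b, hb, hb'⟩ := hasSum_laplacian_antisymm h0 h1 hp hd2 hd1
  obtain ⟨c, hc, hc'⟩ := hasSum_laplacian_antisymm h0 h1 hone (hd2.forward_diff h0 h1)
    (hd1.forward_diff h0 h1)
  have hc0 : c = 0 := hc'.unique (by simp [Dp])
  have hsum : ship h (Dp h (Dm h v2)) v1 - ship h (Dp h (Dm h v1)) v2 = (a + b + c) * h := by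
    refine ((hasSum_shDensity h0 h1 ((hv2.backward_diff h0 h1).forward_diff h0 h1) hv1).sub
      (hasSum_shDensity h0 h1 ((hv1.backward_diff h0 h1).forward_diff h0 h1) hv2)).unique ?_
    refine HasSum.congr_fun (((ha.add hb).add hc).mul_right h) fun m => ?_
    simp only [shDensity, laplacian_forward_diff_comm]
    ring
  have hN := ((hasSum_shDensity h0 h1 hv1 hv1).add (hasSum_shDensity h0 h1 hv2 hv2)).mul_left (-3)
  rw [hsum, hc0, add_zero]
  refine le_of_eq_of_le ?_ (hasSum_le (fun m => ?_) hN ((ha'.add hb').mul_right h))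
  · simp only [shnormSq]
    ring
  have hq : Dp h (fun k : ℤ => jb ((k : ℝ) * h) ^ 2) m = 2 * (m * h) + h := by
    simp only [Dp, jb_sq]
    push_cast
    field_simp
    ring
  have hq2 : (2 * (m * h) + h) ^ 2 ≤ 9 * jb ((m : ℝ) * h) ^ 2 := by
    rw [jb_sq]
    nlinarith [sq_nonneg ((m : ℝ) * h - h)]
  have hjb : 1 ≤ jb ((m : ℝ) * h) ^ 2 := one_le_pow₀ (one_le_jb _)
  simp only [hq, shDensity]
  rw [← add_mul, ← mul_assoc]
  refine mul_le_mul_of_nonneg_right ?_ h0.le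
  generalize 2 * ((m : ℝ) * h) + h = q at *
  generalize jb ((m : ℝ) * h) ^ 2 = W at *
  have young : ∀ x y : ℝ, |q * (x * y)| ≤ 3 / 2 * x ^ 2 + 3 / 2 * (W * y ^ 2) := by
    intro x y
    have := mul_le_mul_of_nonneg_right hq2 (sq_nonneg y)
    rw [abs_le]
    constructor <;> nlinarith [sq_nonneg (3 * x + q * y), sq_nonneg (3 * x - q * y)]
  have y1 := abs_le.1 (young (Dp h v2 m) (v1 m))
  have y2 := abs_le.1 (young (Dp h v1 m) (v2 m))
  have y3 := abs_le.1 (young (Dp h (Dp h v2) m) (Dp h v1 m))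
  have y4 := abs_le.1 (young (Dp h (Dp h v1) m) (Dp h v2 m))
  have w1 := mul_le_mul_of_nonneg_right hjb (sq_nonneg (Dp h v1 m))
  have w2 := mul_le_mul_of_nonneg_right hjb (sq_nonneg (Dp h v2 m))
  have w3 : 0 ≤ W * v1 m ^ 2 := by positivity
  have w4 : 0 ≤ W * v2 m ^ 2 := by positivity
  nlinarith [sq_nonneg (Dp h (Dp h v1) m), sq_nonneg (Dp h (Dp h v2) m)]

/-- Difference quotients of a twice differentiable function are controlled by its derivatives. -/
lemma forward_diff_sq_le {g : ℝ → ℝ} (hg : ContDiff ℝ 2 g) {B h : ℝ} (h0 : 0 < h)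
    (hB : ∀ n ≤ 2, ∀ x, |iteratedDeriv n g x| ≤ B) :
    (∀ m : ℤ, g ((m : ℝ) * h) ^ 2 ≤ B ^ 2) ∧
      (∀ m : ℤ, Dp h (fun k : ℤ => g ((k : ℝ) * h)) m ^ 2 ≤ B ^ 2) ∧
      ∀ m : ℤ, Dp h (Dp h fun k : ℤ => g ((k : ℝ) * h)) m ^ 2 ≤ B ^ 2 := by
  have hd : Differentiable ℝ g := hg.differentiable (by norm_num)
  have hd' : Differentiable ℝ (deriv g) := by
    have := hg.differentiable_iteratedDeriv 1 (by norm_num)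
    rwa [iteratedDeriv_one] at this
  have b1 : ∀ x, ‖deriv g x‖ ≤ B := fun x => by
    have := hB 1 (by norm_num) x
    rwa [iteratedDeriv_one] at this
  have b2 : ∀ x, ‖deriv (deriv g) x‖ ≤ B := fun x => by
    have := hB 2 (by norm_num) x
    rwa [iteratedDeriv_succ, iteratedDeriv_one] at this
  have lip : ∀ {F : ℝ → ℝ} {D : ℝ}, Differentiable ℝ F → (∀ x, ‖deriv F x‖ ≤ D) →
      ∀ x, |F (x + h) - F x| ≤ D * h := by
    intro F D hF hD x
    have := convex_univ.norm_image_sub_le_of_norm_deriv_le (fun y _ => hF y) (fun y _ => hD y)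
      (Set.mem_univ x) (Set.mem_univ (x + h))
    simpa [Real.norm_eq_abs, abs_of_pos h0] using this
  have l1 := lip hd b1
  have hG : Differentiable ℝ fun x => g (x + h) - g x := by fun_prop
  have l2 := lip hG (D := B * h) fun x => by
    have e : deriv (fun x => g (x + h) - g x) x = deriv g (x + h) - deriv g x := by
      rw [deriv_fun_sub (by fun_prop) (by fun_prop), deriv_comp_add_const]
    rw [e]
    exact lip hd' b2 x
  refine ⟨fun m => ?_, fun m => ?_, fun m => ?_⟩ <;> rw [sq_le_sq]
  · have := hB 0 (by norm_num) (m * h)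
    rw [iteratedDeriv_zero] at this
    exact this.trans (le_abs_self B)
  · refine le_trans ?_ (le_abs_self B)
    simp only [Dp]
    rw [abs_div, abs_of_pos h0, div_le_iff₀ h0]
    rw [show ((m + 1 : ℤ) : ℝ) * h = m * h + h by push_cast; ring]
    exact l1 _
  · refine le_trans ?_ (le_abs_self B)
    simp only [Dp]
    rw [← sub_div, abs_div, abs_div, abs_of_pos h0, div_le_iff₀ h0, div_le_iff₀ h0]
    rw [show ((m + 1 + 1 : ℤ) : ℝ) * h = m * h + h + h by push_cast; ring,
      show ((m + 1 : ℤ) : ℝ) * h = m * h + h by push_cast; ring]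
    exact l2 _

/-- the key coercivity estimate `(Q_j u, u)_{S_h} ≥ −C ‖u‖_{S_h}² (1 + ‖u_j‖_{S_h}²)`
with `C` depending only on `f` and `T`. -/
theorem statement9 (μ : ℝ) (hμ : μ = 1 ∨ μ = -1) (T : ℝ) (hT : 0 < T)
    (f1 f2 : ℝ → ℝ → ℝ)
    (hf1s : ∀ n : ℕ, ContDiff ℝ n (Function.uncurry f1))
    (hf2s : ∀ n : ℕ, ContDiff ℝ n (Function.uncurry f2))
    (hfdec : ∀ n : ℕ, ∃ C > (0 : ℝ), ∀ x : ℝ, ∀ t ∈ Set.Icc (0 : ℝ) T,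
      |iteratedDeriv n (fun y => f1 y t) x| ≤ C * jb x ^ (-(n : ℝ)) ∧
      |iteratedDeriv n (fun y => f2 y t) x| ≤ C * jb x ^ (-(n : ℝ))) :
    ∃ C > (0 : ℝ), ∀ h ∈ Set.Ioo (0 : ℝ) 1, ∀ k ∈ Set.Ioo (0 : ℝ) 1,
      ∀ j : ℕ, (j : ℝ) * k ≤ T →
      ∀ u1j u2j : ℤ → ℝ, InSh h u1j → InSh h u2j →
      ∀ v1 v2 : ℤ → ℝ, InSh h v1 → InSh h v2 →
        ship h (Q1 μ h u1j u2j (fun m => f1 ((m : ℝ) * h) ((j : ℝ) * k))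
                  (fun m => f2 ((m : ℝ) * h) ((j : ℝ) * k)) v1 v2) v1
          + ship h (Q2 μ h u1j u2j (fun m => f1 ((m : ℝ) * h) ((j : ℝ) * k))
                  (fun m => f2 ((m : ℝ) * h) ((j : ℝ) * k)) v1 v2) v2
          ≥ -C * shnormSq h v1 v2 * (1 + shnormSq h u1j u2j) := by
  have hbound : ∀ {f : ℝ → ℝ → ℝ}, (∀ n : ℕ, ContDiff ℝ n (Function.uncurry f)) → ∀ {B t : ℝ},
      (∀ n ≤ 2, ∀ x, |iteratedDeriv n (fun y => f y t) x| ≤ B) → ∀ {h : ℝ}, 0 < h →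
      (∀ m : ℤ, f ((m : ℝ) * h) t ^ 2 ≤ B ^ 2) ∧
      (∀ m : ℤ, Dp h (fun k : ℤ => f ((k : ℝ) * h) t) m ^ 2 ≤ B ^ 2) ∧
      ∀ m : ℤ, Dp h (Dp h fun k : ℤ => f ((k : ℝ) * h) t) m ^ 2 ≤ B ^ 2 := by
    intro f hf B t hB h h0
    refine forward_diff_sq_le (g := fun y => f y t) ?_ h0 hB
    exact (hf 2).comp (contDiff_id.prodMk contDiff_const)
  choose c hc0 hc using hfdec
  obtain ⟨B, hB1, hB⟩ : ∃ B : ℝ, 1 ≤ B ∧ ∀ n ≤ 2, ∀ x : ℝ, ∀ t ∈ Set.Icc (0 : ℝ) T,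
      |iteratedDeriv n (fun y => f1 y t) x| ≤ B ∧
      |iteratedDeriv n (fun y => f2 y t) x| ≤ B := by
    refine ⟨1 + c 0 + c 1 + c 2, by linarith [hc0 0, hc0 1, hc0 2], fun n hn x t ht => ?_⟩
    have hle : c n * jb x ^ (-(n : ℝ)) ≤ 1 + c 0 + c 1 + c 2 := by
      have h1 : jb x ^ (-(n : ℝ)) ≤ 1 :=
        Real.rpow_le_one_of_one_le_of_nonpos (one_le_jb x) (by simp)
      have h2 : c n * jb x ^ (-(n : ℝ)) ≤ c n := mul_le_of_le_one_right (hc0 n).le h1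
      interval_cases n <;> linarith [hc0 0, hc0 1, hc0 2]
    exact ⟨(hc n x t ht).1.trans hle, (hc n x t ht).2.trans hle⟩
  refine ⟨3 + 320 * B, by linarith, ?_⟩
  rintro h ⟨h0, h1⟩ k ⟨hk0, -⟩ j hj u1 u2 hu1 hu2 v1 v2 hv1 hv2
  replace hu1 := hu1.weightedL2 h0
  replace hu2 := hu2.weightedL2 h0
  replace hv1 := hv1.weightedL2 h0
  replace hv2 := hv2.weightedL2 h0
  have ht : (j : ℝ) * k ∈ Set.Icc (0 : ℝ) T := ⟨by positivity, hj⟩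
  have hF1 := hbound hf1s (fun n hn x => (hB n hn x _ ht).1) h0
  have hF2 := hbound hf2s (fun n hn x => (hB n hn x _ ht).2) h0
  set F1 : ℤ → ℝ := fun m => f1 ((m : ℝ) * h) ((j : ℝ) * k)
  set F2 : ℤ → ℝ := fun m => f2 ((m : ℝ) * h) ((j : ℝ) * k)
  have nu1 := ship_self_nonneg h0 h1 hu1
  have nu2 := ship_self_nonneg h0 h1 hu2
  have nv1 := ship_self_nonneg h0 h1 hv1
  have nv2 := ship_self_nonneg h0 h1 hv2
  set M := shnormSq h u1 u2 with hM
  set S := shnormSq h v1 v2 with hS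
  have hu1M : ship h u1 u1 ≤ M := by rw [hM, shnormSq]; linarith
  have hu2M : ship h u2 u2 ≤ M := by rw [hM, shnormSq]; linarith
  have hv1S : ship h v1 v1 ≤ S := by rw [hS, shnormSq]; linarith
  have hv2S : ship h v2 v2 ≤ S := by rw [hS, shnormSq]; linarith
  have hM0 : 0 ≤ M := nu1.trans hu1M
  have hS0 : 0 ≤ S := nv1.trans hv1S
  set K := 20 * B * (1 + M) with hK
  have hKpos : 0 < K := by positivity
  have quad : ∀ {u u' r w : ℤ → ℝ}, WeightedL2 h u → WeightedL2 h u' → WeightedL2 h r →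
      WeightedL2 h w → ship h u u ≤ M → ship h u' u' ≤ M → ship h r r ≤ S → ship h w w ≤ S →
      WeightedL2 h (u * u' * r) ∧ |ship h (u * u' * r) w| ≤ K * S := by
    intro u u' r w hu hu' hr hw nu nu' nr nw
    have huu' : WeightedL2 h (u * u') := hu'.bdd_mul (sq_le_ship_self h0 h1 hu)
    have hur : WeightedL2 h (u * u' * r) := hr.bdd_mul (sq_le_ship_self h0 h1 huu')
    refine ⟨hur, abs_ship_le h0 h1 hKpos hur hw ?_ nw⟩
    calc _ ≤ 20 * (ship h (u * u') (u * u') * ship h r r) := ship_mul_self_le h0 h1 huu' hr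
      _ ≤ 20 * (20 * (M * M) * S) := by
        have := ship_self_nonneg h0 h1 hr
        have := ship_self_nonneg h0 h1 hu
        have := ship_self_nonneg h0 h1 hu'
        gcongr
        refine (ship_mul_self_le h0 h1 hu hu').trans ?_
        gcongr
      _ = 20 ^ 2 * 1 ^ 2 * M ^ 2 * S := by ring
      _ ≤ 20 ^ 2 * B ^ 2 * (1 + M) ^ 2 * S := by gcongr; linarith
      _ = K ^ 2 * S := by rw [hK]; ring
  have lin : ∀ {f u r w : ℤ → ℝ}, ((∀ m, f m ^ 2 ≤ B ^ 2) ∧ (∀ m, Dp h f m ^ 2 ≤ B ^ 2) ∧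
      ∀ m, Dp h (Dp h f) m ^ 2 ≤ B ^ 2) → WeightedL2 h u → WeightedL2 h r → WeightedL2 h w →
      ship h u u ≤ M → ship h r r ≤ S → ship h w w ≤ S →
      WeightedL2 h (f * u * r) ∧ |ship h (f * u * r) w| ≤ K * S := by
    rintro f u r w ⟨f0, f1, f2⟩ hu hr hw nu nr nw
    have hfu : WeightedL2 h (f * u) := hu.bdd_mul f0
    have hur : WeightedL2 h (f * u * r) := hr.bdd_mul (sq_le_ship_self h0 h1 hfu)
    refine ⟨hur, abs_ship_le h0 h1 hKpos hur hw ?_ nw⟩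
    calc _ ≤ 20 * (ship h (f * u) (f * u) * ship h r r) := ship_mul_self_le h0 h1 hfu hr
      _ ≤ 20 * (20 * (B ^ 2 * M) * S) := by
        have := ship_self_nonneg h0 h1 hr
        gcongr
        refine (ship_bdd_mul_self_le h0 h1 f0 f1 f2 hu).trans ?_
        gcongr
      _ = 20 ^ 2 * B ^ 2 * M * S := by ring
      _ ≤ 20 ^ 2 * B ^ 2 * (1 + M) ^ 2 * S := by gcongr; nlinarith
      _ = K ^ 2 * S := by rw [hK]; ring
  have hμ1 : |μ| = 1 := by rcases hμ with rfl | rfl <;> simp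
  have hscale : ∀ {x : ℝ} (c : ℝ), |x| ≤ K * S → -(|c| * (K * S)) ≤ c * μ * x := by
    intro x c hx
    refine le_trans (neg_le_neg ?_) (neg_abs_le _)
    rw [abs_mul, abs_mul, hμ1, mul_one]
    exact mul_le_mul_of_nonneg_left hx (abs_nonneg c)
  obtain ⟨wa1, a1⟩ := quad hu1 hu2 hv1 hv1 hu1M hu2M hv1S hv1S
  obtain ⟨wa2, a2⟩ := quad hu2 hu2 hv2 hv1 hu2M hu2M hv2S hv1S
  obtain ⟨wa3, a3⟩ := lin hF1 hu2 hv1 hv1 hu2M hv1S hv1S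
  obtain ⟨wa4, a4⟩ := lin hF2 hu1 hv1 hv1 hu1M hv1S hv1S
  obtain ⟨wa5, a5⟩ := lin hF2 hu2 hv2 hv1 hu2M hv2S hv1S
  obtain ⟨wb1, b1⟩ := quad hu1 hu1 hv1 hv2 hu1M hu1M hv1S hv2S
  obtain ⟨wb2, b2⟩ := quad hu1 hu2 hv2 hv2 hu1M hu2M hv2S hv2S
  obtain ⟨wb3, b3⟩ := lin hF1 hu1 hv1 hv2 hu1M hv1S hv2S
  obtain ⟨wb4, b4⟩ := lin hF1 hu2 hv2 hv2 hu2M hv2S hv2S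
  obtain ⟨wb5, b5⟩ := lin hF2 hu1 hv2 hv2 hu1M hv2S hv2S
  have expand : ∀ {L p1 p2 p3 p4 p5 w : ℤ → ℝ} (d c1 c2 c3 c4 c5 : ℝ), WeightedL2 h L →
      WeightedL2 h p1 → WeightedL2 h p2 → WeightedL2 h p3 → WeightedL2 h p4 → WeightedL2 h p5 →
      WeightedL2 h w →
      ship h (d • L + c1 • p1 + c2 • p2 + c3 • p3 + c4 • p4 + c5 • p5) w =
        d * ship h L w + c1 * ship h p1 w + c2 * ship h p2 w + c3 * ship h p3 w
          + c4 * ship h p4 w + c5 * ship h p5 w := by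
    intro L p1 p2 p3 p4 p5 w d c1 c2 c3 c4 c5 hL q1 q2 q3 q4 q5 hw
    have r1 := (hL.smul d).add (q1.smul c1)
    have r2 := r1.add (q2.smul c2)
    have r3 := r2.add (q3.smul c3)
    have r4 := r3.add (q4.smul c4)
    rw [ship_add_left h0 h1 r4 (q5.smul c5) hw, ship_add_left h0 h1 r3 (q4.smul c4) hw,
      ship_add_left h0 h1 r2 (q3.smul c3) hw, ship_add_left h0 h1 r1 (q2.smul c2) hw,
      ship_add_left h0 h1 (hL.smul d) (q1.smul c1) hw, ship_smul_left h0 h1 d hL hw,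
      ship_smul_left h0 h1 c1 q1 hw, ship_smul_left h0 h1 c2 q2 hw,
      ship_smul_left h0 h1 c3 q3 hw, ship_smul_left h0 h1 c4 q4 hw, ship_smul_left h0 h1 c5 q5 hw]
  have e1 : Q1 μ h u1 u2 F1 F2 v1 v2 = (1 : ℝ) • Dp h (Dm h v2) + (1 * μ) • (u1 * u2 * v1)
      + (1 * μ) • (u2 * u2 * v2) + (2 * μ) • (F1 * u2 * v1) + (1 * μ) • (F2 * u1 * v1)
      + (3 * μ) • (F2 * u2 * v2) := by
    funext m
    simp only [Q1, Pi.add_apply, Pi.smul_apply, Pi.mul_apply, smul_eq_mul]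
    ring
  have e2 : Q2 μ h u1 u2 F1 F2 v1 v2 = (-1 : ℝ) • Dp h (Dm h v1) + (-1 * μ) • (u1 * u1 * v1)
      + (-1 * μ) • (u1 * u2 * v2) + (-3 * μ) • (F1 * u1 * v1) + (-1 * μ) • (F1 * u2 * v2)
      + (-2 * μ) • (F2 * u1 * v2) := by
    funext m
    simp only [Q2, Pi.add_apply, Pi.smul_apply, Pi.mul_apply, smul_eq_mul]
    ring
  have hL := ship_laplacian_antisymm_ge h0 h1 hv1 hv2
  rw [← hS] at hL
  rw [e1, e2, expand _ _ _ _ _ _ ((hv2.backward_diff h0 h1).forward_diff h0 h1)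
      wa1 wa2 wa3 wa4 wa5 hv1,
    expand _ _ _ _ _ _ ((hv1.backward_diff h0 h1).forward_diff h0 h1) wb1 wb2 wb3 wb4 wb5 hv2]
  have s1 := hscale 1 a1
  have s2 := hscale 1 a2
  have s3 := hscale 2 a3
  have s4 := hscale 1 a4
  have s5 := hscale 3 a5
  have s6 := hscale (-1) b1
  have s7 := hscale (-1) b2
  have s8 := hscale (-3) b3
  have s9 := hscale (-1) b4
  have s10 := hscale (-2) b5
  rw [abs_neg] at s6 s7 s8 s9 s10
  rw [abs_one] at s1 s2 s4 s6 s7 s9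
  rw [abs_of_pos (by norm_num)] at s3 s5 s8 s10
  have hKS : 16 * (K * S) = 320 * B * S * (1 + M) := by rw [hK]; ring
  nlinarith [mul_nonneg hS0 hM0]
end
end
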